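/- arXiv:2307.04204 — 5 statements merged into one kernel-verified Lean document; each statement's English description precedes it below -/
import Mathlib

section
/- For every constant K > 0 there exist η₀ > 0 and C > 0 depending only on δ, ℓ, and K such that for every step size η ∈ (0, η₀) the following holds. Suppose |p₀| ≤ 1, q₀ ∈ (c₀, 1-δ), and p_t ≠ 0 whenever q_t < 1. If at some time step t with q_t ≤ 1 one has |s_t − 1| ≤ Kη² (where s_t = q_t/r(p_t)), then |s_{t+1} − 1 − h(p_{t+1})η²| ≤ (1 + 2p_t r'(p_t)/r(p_t)) · |s_t − 1 − h(p_t)η²| + C η⁴ p_t². -/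
open Filter
open scoped Classical

noncomputable section

/-- Assumption (L): `l` is convex, even, 1-Lipschitz, twice differentiable, `l'' 0 = 1`. -/
def AssumptionL (l : ℝ → ℝ) : Prop :=
  ConvexOn ℝ Set.univ l ∧ (∀ x, l (-x) = l x) ∧ LipschitzWith 1 l ∧
  (∀ x, DifferentiableAt ℝ l x) ∧ (∀ x, DifferentiableAt ℝ (deriv l) x) ∧
  deriv (deriv l) 0 = 1

/-- Assumption (R). -/
def AssumptionR (r : ℝ → ℝ) : Prop :=
  (∀ p, r (-p) = r p) ∧ ContDiff ℝ 1 r ∧ r 0 = 1 ∧ deriv r 0 = 0 ∧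
  (∀ p, 0 < p → deriv r p < 0) ∧
  Tendsto r atTop (nhds 0) ∧ Tendsto r atBot (nhds 0)

/-- Assumption (R2). -/
def AssumptionR2 (r : ℝ → ℝ) : Prop :=
  ContDiff ℝ 4 r ∧
  StrictAnti (fun z => deriv r z / (r z) ^ 2) ∧
  StrictAntiOn (fun z => z * deriv r z / r z) (Set.Ioi 0) ∧
  StrictMonoOn (fun z => z * deriv r z / r z) (Set.Iio 0) ∧
  StrictAntiOn (fun z => z * r z / deriv r z) (Set.Ioi 0) ∧
  StrictMonoOn (fun z => z * r z / deriv r z) (Set.Iio 0)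

/-- The reparameterized GD dynamics for the two-layer fully-connected linear network. -/
def LinDyn (r : ℝ → ℝ) (η : ℝ) (p q : ℕ → ℝ) : Prop :=
  (∀ t, p (t + 1) = (1 - 2 * r (p t) / q t + η ^ 2 * (p t) ^ 2 * (r (p t)) ^ 2) * p t) ∧
  (∀ t, q (t + 1) = (1 - η ^ 2 * (p t) ^ 2 * r (p t) * (2 * q t - r (p t)))⁻¹ * q t)

/-- `z₀ = sup {z : z r'(z)/r(z) ≥ -1/2}`. -/
def zZero (r : ℝ → ℝ) : ℝ := sSup {z : ℝ | z * deriv r z / r z ≥ -(1 / 2)}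

/-- `c₀ = max {r(z₀), 1/2}`. -/
def cZero (r : ℝ → ℝ) : ℝ := max (r (zZero r)) (1 / 2)

/-- The function `h` of Theorem (EoS regime, Phase I). -/
def hFun (r : ℝ → ℝ) (p : ℝ) : ℝ :=
  if p = 0 then -(1 / (2 * deriv (deriv r) 0))
  else -(1 / 2) * (p * (r p) ^ 3 / deriv r p + p ^ 2 * (r p) ^ 2)


lemma aux_lip (f : ℝ → ℝ) (hf : ContDiff ℝ 1 f) (M : ℝ) :
    ∃ L : ℝ, 0 < L ∧ ∀ x ∈ Set.Icc (-M) M, ∀ y ∈ Set.Icc (-M) M, |f x - f y| ≤ L * |x - y| := by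
  have hc : Continuous (deriv f) := hf.continuous_deriv le_rfl
  obtain ⟨C, hC⟩ := (isCompact_Icc (a := -M) (b := M)).exists_bound_of_continuousOn hc.continuousOn
  refine ⟨|C| + 1, by positivity, fun x hx y hy => ?_⟩
  have := Convex.norm_image_sub_le_of_norm_deriv_le (f := f) (C := |C| + 1) (s := Set.Icc (-M) M)
    (fun z _ => (hf.differentiable one_ne_zero) z)
    (fun z hz => (hC z hz).trans (by linarith [le_abs_self C])) (convex_Icc _ _) hy hx
  simpa [Real.norm_eq_abs] using this

def SqLip (N : ℝ) (f : ℝ → ℝ) : Prop :=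
  ∃ C : ℝ, 0 ≤ C ∧ (∀ x ∈ Set.Ioc 0 N, |f x| ≤ C) ∧
    ∀ x ∈ Set.Ioc 0 N, ∀ y ∈ Set.Ioc 0 N, |f x - f y| ≤ C * |x ^ 2 - y ^ 2|

lemma SqLip.of_deriv {N : ℝ} (hN : 0 < N) {f f' : ℝ → ℝ} {C : ℝ} (hC : 0 ≤ C)
    (hd : ∀ x ∈ Set.Ioc 0 N, HasDerivAt f (f' x) x)
    (hb : ∀ x ∈ Set.Ioc 0 N, |f' x| ≤ C * x) : SqLip N f := by
  have key : ∀ x ∈ Set.Ioc 0 N, ∀ y ∈ Set.Ioc 0 N, |f x - f y| ≤ C * |x ^ 2 - y ^ 2| := by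
    intro x hx y hy
    have hsub : Set.uIcc y x ⊆ Set.Ioc 0 N := by
      intro z hz
      rw [Set.mem_uIcc] at hz
      rcases hz with h | h
      · exact ⟨hy.1.trans_le h.1, h.2.trans hx.2⟩
      · exact ⟨hx.1.trans_le h.1, h.2.trans hy.2⟩
    have := Convex.norm_image_sub_le_of_norm_hasDerivWithin_le (f := f) (f' := f')
      (C := C * (x + y)) (s := Set.uIcc y x)
      (fun z hz => (hd z (hsub hz)).hasDerivWithinAt)
      (fun z hz => by
        rw [Real.norm_eq_abs]
        refine (hb z (hsub hz)).trans (mul_le_mul_of_nonneg_left ?_ hC)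
        rw [Set.mem_uIcc] at hz
        rcases hz with h | h
        · linarith [hy.1, h.2]
        · linarith [hx.1, h.2]) (convex_uIcc _ _) Set.left_mem_uIcc Set.right_mem_uIcc
    rw [Real.norm_eq_abs, Real.norm_eq_abs] at this
    have e : x ^ 2 - y ^ 2 = (x + y) * (x - y) := by ring
    rw [e, abs_mul, abs_of_pos (add_pos hx.1 hy.1), ← mul_assoc]
    exact this
  refine ⟨|f N| + C * N ^ 2 + C, by positivity, fun x hx => ?_, fun x hx y hy => ?_⟩
  · have h1 := key x hx N ⟨hN, le_rfl⟩
    have h2 : |x ^ 2 - N ^ 2| ≤ N ^ 2 := by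
      rw [abs_le]; constructor
      · nlinarith [sq_nonneg x]
      · nlinarith [sq_nonneg N, hx.1, hx.2]
    have h3 := mul_le_mul_of_nonneg_left h2 hC
    have h4 : |f x| ≤ |f x - f N| + |f N| := by
      have := abs_add_le (f x - f N) (f N)
      simpa using this
    linarith
  · refine (key x hx y hy).trans (mul_le_mul_of_nonneg_right ?_ (abs_nonneg _))
    have : 0 ≤ |f N| + C * N ^ 2 := by positivity
    linarith

lemma SqLip.mul {N : ℝ} {f g : ℝ → ℝ} (hf : SqLip N f) (hg : SqLip N g) :
    SqLip N (fun x => f x * g x) := by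
  obtain ⟨C, hC, hb, hl⟩ := hf
  obtain ⟨D, hD, hb', hl'⟩ := hg
  have h0 : 0 ≤ C * D := by positivity
  refine ⟨2 * (C * D), by positivity, fun x hx => ?_, fun x hx y hy => ?_⟩
  · rw [abs_mul]
    have := mul_le_mul (hb x hx) (hb' x hx) (abs_nonneg _) hC
    linarith
  · have e : f x * g x - f y * g y = (f x - f y) * g x + f y * (g x - g y) := by ring
    rw [e]
    refine (abs_add_le _ _).trans ?_
    rw [abs_mul, abs_mul]
    have h1 := mul_le_mul (hl x hx y hy) (hb' x hx) (abs_nonneg _) (by positivity)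
    have h2 := mul_le_mul (hb y hy) (hl' x hx y hy) (abs_nonneg _) hC
    nlinarith

lemma SqLip.add {N : ℝ} {f g : ℝ → ℝ} (hf : SqLip N f) (hg : SqLip N g) :
    SqLip N (fun x => f x + g x) := by
  obtain ⟨C, hC, hb, hl⟩ := hf
  obtain ⟨D, hD, hb', hl'⟩ := hg
  refine ⟨C + D, by positivity, fun x hx => ?_, fun x hx y hy => ?_⟩
  · exact (abs_add_le _ _).trans (add_le_add (hb x hx) (hb' x hx))
  · have e : f x + g x - (f y + g y) = (f x - f y) + (g x - g y) := by ring
    rw [e]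
    refine (abs_add_le _ _).trans ?_
    have h1 := hl x hx y hy
    have h2 := hl' x hx y hy
    nlinarith

lemma SqLip.const {N : ℝ} (c : ℝ) : SqLip N (fun _ => c) :=
  ⟨|c|, abs_nonneg _, fun _ _ => le_rfl, fun x _ y _ => by simp; positivity⟩

lemma deriv_odd_of_even {f : ℝ → ℝ} (hf : ∀ x, f (-x) = f x) (x : ℝ) :
    deriv f (-x) = - deriv f x := by
  have h := deriv_comp_neg f x
  have e : (fun x => f (-x)) = f := funext hf
  rw [e] at h
  linarith

lemma deriv_even_of_odd {f : ℝ → ℝ} (hf : ∀ x, f (-x) = - f x) (x : ℝ) :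
    deriv f (-x) = deriv f x := by
  have h := deriv_comp_neg f x
  have e : (fun x => f (-x)) = fun x => - f x := funext hf
  rw [e, deriv.fun_neg] at h
  linarith

/-- The trajectory never goes below its initial value of `q`. -/
lemma traj {r : ℝ → ℝ} {η : ℝ} {p q : ℕ → ℝ} (hη : 0 < η) (hη1 : η < 1)
    (hd : LinDyn r η p q) (hrpos : ∀ x, 0 < r x) (hr1 : ∀ x, r x ≤ 1)
    (hpr : ∀ x, |x * r x| ≤ 1) (hp0 : |p 0| ≤ 1) (hq0 : 1 / 2 < q 0) (hq1 : q 0 < 1) :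
    ∀ t, q 0 ≤ q t := by
  obtain ⟨hP, hQ⟩ := hd
  have inv : ∀ t, q 0 ≤ q t ∧ η * p t < (q t)⁻¹ ∧ -(η * p t) < (q t)⁻¹ := by
    intro t
    induction t with
    | zero =>
      have h1 : 1 < (q 0)⁻¹ := (one_lt_inv₀ (by linarith)).2 hq1
      rw [abs_le] at hp0
      refine ⟨le_rfl, ?_, ?_⟩ <;> nlinarith
    | succ t ih =>
      obtain ⟨i1, i2, i3⟩ := ih
      have hqp : 0 < q t := by linarith
      set u := (q t)⁻¹ with hu
      have hupos : 0 < u := inv_pos.2 hqp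
      have hu2 : u < 2 := by
        rw [hu, inv_lt_comm₀ hqp (by norm_num)]; linarith
      have hPt := hP t
      have hQt : (q (t + 1))⁻¹ = u - η ^ 2 * (p t) ^ 2 * r (p t) * (2 - r (p t) * u) := by
        rw [hQ t, mul_inv, inv_inv, hu]; field_simp
      have hPu : p (t + 1) = (1 - 2 * r (p t) * u + η ^ 2 * (p t) ^ 2 * (r (p t)) ^ 2) * p t := by
        rw [hPt, hu, div_eq_mul_inv]
      have hb := abs_le.1 (hpr (p t))
      have hs1 : 0 < 1 + η * (p t * r (p t)) := by nlinarith
      have hs2 : 0 < 1 - η * (p t * r (p t)) := by nlinarith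
      have e1 : (q (t + 1))⁻¹ - η * p (t + 1)
          = (u - η * p t) * (1 + η * (p t * r (p t))) ^ 2 := by rw [hQt, hPu]; ring
      have e2 : (q (t + 1))⁻¹ + η * p (t + 1)
          = (u + η * p t) * (1 - η * (p t * r (p t))) ^ 2 := by rw [hQt, hPu]; ring
      have p1 : 0 < (u - η * p t) * (1 + η * (p t * r (p t))) ^ 2 :=
        mul_pos (by linarith) (by positivity)
      have p2 : 0 < (u + η * p t) * (1 - η * (p t * r (p t))) ^ 2 :=
        mul_pos (by linarith) (by positivity)
      have hpos : 0 < (q (t + 1))⁻¹ := by linarith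
      have hle : (q (t + 1))⁻¹ ≤ u := by
        rw [hQt]
        have h1 : 0 ≤ 2 - r (p t) * u := by nlinarith [hrpos (p t), hr1 (p t)]
        have h2 : 0 ≤ η ^ 2 * (p t) ^ 2 * r (p t) * (2 - r (p t) * u) := by
          have := hrpos (p t)
          positivity
        linarith
      refine ⟨?_, by linarith, by linarith⟩
      have : q t ≤ q (t + 1) := by
        rw [hu] at hle
        exact (inv_le_inv₀ (inv_pos.1 hpos) hqp).1 hle
      linarith
  exact fun t => (inv t).1

set_option maxHeartbeats 1000000 in
lemma core {K L M e p rr A w σ ε : ℝ} (hK : 0 < K) (hL : 0 < L) (he : 0 < e) (he2 : e ≤ 1 / 2)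
    (hKe : K * e ≤ 1 / 4) (hpM : p ^ 2 ≤ M ^ 2) (hrr : rr ^ 2 ≤ 1)
    (hpr : p ^ 2 * rr ^ 2 ≤ 1) (hσ : |σ| ≤ K * e) (hε : ε = 2 - 2 / (1 + σ) + e * (p ^ 2 * rr ^ 2))
    (hA : |A| ≤ L * p ^ 2) (hεb : |ε| ≤ (4 * K + 1) * e)
    (hw : |w - 1 + ε * A| ≤ L * ε ^ 2 * p ^ 2)
    {C1 C3 : ℝ}
    (hC1 : C1 = 2 * K + 4 * K ^ 2 * L + 2 * L * (4 * K + 1) ^ 2 + 2 * L * (4 * K + 1))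
    (hC3 : C3 = C1 + (1 + (2 * K + 1) * L)) (hC3e : C3 * e * M ^ 2 ≤ 1 / 2) :
    |(1 + σ) / ((1 - e * (p ^ 2 * rr ^ 2) * (1 + 2 * σ)) * w) - 1 - σ
      - (e * (p ^ 2 * rr ^ 2) + (2 * σ + e * (p ^ 2 * rr ^ 2)) * A)| ≤
      (C1 + K * C3 + 3 * C3 ^ 2 * M ^ 2) * (e ^ 2 * p ^ 2) := by
  have hσ' := abs_le.1 hσ
  have hspos : 3 / 4 ≤ 1 + σ := by linarith
  have hs0 : 0 < 1 + σ := by linarith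
  have hp2 : 0 ≤ p ^ 2 := sq_nonneg p
  have hr2 : 0 ≤ rr ^ 2 := sq_nonneg rr
  set X := p ^ 2 * rr ^ 2 with hX
  have hX0 : 0 ≤ X := by positivity
  have hXp : X ≤ p ^ 2 := by nlinarith
  have hσ2 : σ ^ 2 ≤ (K * e) ^ 2 := sq_le_sq' (by linarith) (by linarith)
  have hB : |ε - 2 * σ - e * X| ≤ 4 * K ^ 2 * e ^ 2 := by
    have h : ε - 2 * σ - e * X = - (2 * σ ^ 2 / (1 + σ)) := by
      rw [hε]; field_simp; ring
    rw [h, abs_neg, abs_of_nonneg (by positivity), div_le_iff₀ hs0]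
    have h4 : 0 ≤ (4 * K ^ 2 * e ^ 2) * (1 + σ - 3 / 4) := by
      apply mul_nonneg (by positivity); linarith
    nlinarith
  set R := w - 1 + ε * A with hR
  set b := e * X * (1 + 2 * σ) with hb
  have hwR : w = 1 - ε * A + R := by rw [hR]; ring
  have hb0 : 0 ≤ b := by
    rw [hb]; apply mul_nonneg (by positivity); linarith
  have heX : e * X ≤ e := mul_le_of_le_one_right he.le hpr
  have heX0 : 0 ≤ e * X := by positivity
  have hb1 : b ≤ 2 * e := by
    rw [hb]; nlinarith
  set τ0 := e * X + (2 * σ + e * X) * A with hτ0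
  set τ := 1 - (1 - b) * w with hτ
  have hdiff : τ - τ0 = e * X * (2 * σ) + (ε - 2 * σ - e * X) * A - R * (1 - b) - b * ε * A := by
    rw [hτ, hwR, hτ0, hb]; ring
  have t1 : |e * X * (2 * σ)| ≤ 2 * K * (e ^ 2 * p ^ 2) := by
    rw [abs_mul, abs_of_nonneg heX0, abs_mul, abs_two]
    calc e * X * (2 * |σ|) ≤ e * p ^ 2 * (2 * (K * e)) := by gcongr
      _ = _ := by ring
  have t2 : |(ε - 2 * σ - e * X) * A| ≤ 4 * K ^ 2 * L * (e ^ 2 * p ^ 2) := by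
    rw [abs_mul]
    calc _ ≤ 4 * K ^ 2 * e ^ 2 * (L * p ^ 2) := by gcongr
      _ = _ := by ring
  have hε2 : ε ^ 2 ≤ ((4 * K + 1) * e) ^ 2 := by
    rw [← sq_abs]; gcongr
  have t3 : |R * (1 - b)| ≤ 2 * L * (4 * K + 1) ^ 2 * (e ^ 2 * p ^ 2) := by
    rw [abs_mul]
    have hb2 : |1 - b| ≤ 1 := by rw [abs_le]; constructor <;> linarith
    calc _ ≤ L * ε ^ 2 * p ^ 2 * 1 := by gcongr
      _ ≤ L * ((4 * K + 1) * e) ^ 2 * p ^ 2 * 1 := by gcongr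
      _ ≤ 2 * (L * ((4 * K + 1) * e) ^ 2 * p ^ 2 * 1) := by
        have : 0 ≤ L * ((4 * K + 1) * e) ^ 2 * p ^ 2 * 1 := by positivity
        linarith
      _ = _ := by ring
  have t4 : |b * ε * A| ≤ 2 * L * (4 * K + 1) * (e ^ 2 * p ^ 2) := by
    rw [abs_mul, abs_mul, abs_of_nonneg hb0]
    calc _ ≤ (2 * e) * ((4 * K + 1) * e) * (L * p ^ 2) := by gcongr
      _ = _ := by ring
  have hd : |τ - τ0| ≤ C1 * (e ^ 2 * p ^ 2) := by
    rw [hdiff, hC1]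
    have a1 := abs_add_le (e * X * (2 * σ)) ((ε - 2 * σ - e * X) * A)
    have a2 := abs_sub (e * X * (2 * σ) + (ε - 2 * σ - e * X) * A) (R * (1 - b))
    have a3 := abs_sub (e * X * (2 * σ) + (ε - 2 * σ - e * X) * A - R * (1 - b)) (b * ε * A)
    linarith
  have hC1p : 0 < C1 := by rw [hC1]; positivity
  have hC3p : 0 < C3 := by rw [hC3]; positivity
  have hτ0b : |τ0| ≤ (1 + (2 * K + 1) * L) * (e * p ^ 2) := by
    rw [hτ0]
    refine (abs_add_le _ _).trans ?_
    rw [abs_of_nonneg heX0, abs_mul]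
    have h1 : |2 * σ + e * X| ≤ (2 * K + 1) * e := by
      rw [abs_le]; constructor <;> linarith
    calc _ ≤ e * p ^ 2 + (2 * K + 1) * e * (L * p ^ 2) := by gcongr
      _ = _ := by ring
  have hep : 0 ≤ e * p ^ 2 := by positivity
  have hτb : |τ| ≤ C3 * (e * p ^ 2) := by
    have h1 : |τ| ≤ |τ - τ0| + |τ0| := by
      have := abs_add_le (τ - τ0) τ0; simpa using this
    have h2 : C1 * (e ^ 2 * p ^ 2) ≤ C1 * (e * p ^ 2) := by
      apply mul_le_mul_of_nonneg_left _ hC1p.le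
      have := mul_le_mul_of_nonneg_right (show e ≤ 1 by linarith) hep
      linarith
    rw [hC3]; linarith
  have hτh : |τ| ≤ 1 / 2 := by
    refine hτb.trans (le_trans ?_ hC3e)
    rw [mul_assoc]; gcongr
  have hτh' := abs_le.1 hτh
  have h1τ : 1 / 2 ≤ 1 - τ := by linarith
  have h1τp : 0 < 1 - τ := by linarith
  have hden : (1 - b) * w = 1 - τ := by rw [hτ]; ring
  rw [hden]
  have e1 : (1 + σ) / (1 - τ) - 1 - σ - τ0 = (τ - τ0) + σ * τ + (1 + σ) * τ ^ 2 / (1 - τ) := by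
    field_simp; ring
  rw [e1]
  have u1 : |σ * τ| ≤ K * C3 * (e ^ 2 * p ^ 2) := by
    rw [abs_mul]
    calc _ ≤ (K * e) * (C3 * (e * p ^ 2)) := by gcongr
      _ = _ := by ring
  have hτ2 : τ ^ 2 ≤ C3 ^ 2 * M ^ 2 * (e ^ 2 * p ^ 2) := by
    rw [← sq_abs]
    calc |τ| ^ 2 ≤ (C3 * (e * p ^ 2)) ^ 2 := by gcongr
      _ = C3 ^ 2 * p ^ 2 * (e ^ 2 * p ^ 2) := by ring
      _ ≤ _ := by gcongr
  have u2 : |(1 + σ) * τ ^ 2 / (1 - τ)| ≤ 3 * C3 ^ 2 * M ^ 2 * (e ^ 2 * p ^ 2) := by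
    rw [abs_of_nonneg (by positivity), div_le_iff₀ h1τp]
    have h0 : 0 ≤ τ ^ 2 := sq_nonneg _
    set Y := C3 ^ 2 * M ^ 2 * (e ^ 2 * p ^ 2) with hY
    have hYe : 3 * C3 ^ 2 * M ^ 2 * (e ^ 2 * p ^ 2) = 3 * Y := by rw [hY]; ring
    have hs54 : 1 + σ ≤ 5 / 4 := by linarith
    rw [hYe]
    have hY0 : 0 ≤ Y := h0.trans hτ2
    have v1 : (1 + σ) * τ ^ 2 ≤ 5 / 4 * Y := mul_le_mul hs54 hτ2 h0 (by norm_num)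
    have v2 : 3 * Y * (1 / 2) ≤ 3 * Y * (1 - τ) :=
      mul_le_mul_of_nonneg_left h1τ (by linarith)
    linarith
  calc _ ≤ |τ - τ0 + σ * τ| + |(1 + σ) * τ ^ 2 / (1 - τ)| := abs_add_le _ _
    _ ≤ |τ - τ0| + |σ * τ| + |(1 + σ) * τ ^ 2 / (1 - τ)| := by gcongr; exact abs_add_le _ _
    _ ≤ _ := by linarith

lemma SqLip.congr {N : ℝ} {f g : ℝ → ℝ} (hf : SqLip N f) (h : ∀ x ∈ Set.Ioc 0 N, g x = f x) :
    SqLip N g := by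
  obtain ⟨C, hC, hb, hl⟩ := hf
  refine ⟨C, hC, fun x hx => ?_, fun x hx y hy => ?_⟩
  · rw [h x hx]; exact hb x hx
  · rw [h x hx, h y hy]; exact hl x hx y hy

lemma r_anti {r : ℝ → ℝ} (hR : AssumptionR r) : StrictAntiOn r (Set.Ici 0) := by
  obtain ⟨_, hc, _, _, hn, _, _⟩ := hR
  refine strictAntiOn_of_deriv_neg (convex_Ici 0) hc.continuous.continuousOn ?_
  intro x hx
  rw [interior_Ici] at hx
  exact hn x hx

lemma r_abs {r : ℝ → ℝ} (hR : AssumptionR r) (x : ℝ) : r |x| = r x := by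
  rcases abs_choice x with h | h <;> rw [h]
  exact hR.1 x

lemma r_pos {r : ℝ → ℝ} (hR : AssumptionR r) (x : ℝ) : 0 < r x := by
  rw [← r_abs hR]
  have ha := r_anti hR
  have h0 : 0 ≤ |x| := abs_nonneg x
  have h1 : r (|x| + 1) < r |x| := ha h0 (by simp only [Set.mem_Ici]; linarith) (by linarith)
  have h2 : 0 ≤ r (|x| + 1) := by
    refine le_of_tendsto hR.2.2.2.2.2.1 ?_
    filter_upwards [eventually_ge_atTop (|x| + 1)] with y hy
    exact ha.antitoneOn (by simp only [Set.mem_Ici]; linarith) (by simp only [Set.mem_Ici]; linarith) hy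
  linarith

lemma r_le_one {r : ℝ → ℝ} (hR : AssumptionR r) (x : ℝ) : r x ≤ 1 := by
  rw [← r_abs hR, ← hR.2.2.1]
  exact (r_anti hR).antitoneOn (by simp) (by simp) (abs_nonneg x)

lemma deriv_low {r : ℝ → ℝ} (hR : AssumptionR r) (hR2 : AssumptionR2 r) {N : ℝ} (hN : 0 < N) :
    ∃ c : ℝ, 0 < c ∧ ∀ x ∈ Set.Ioc 0 N, c * x ≤ - deriv r x := by
  have hanti := hR2.2.2.2.2.1
  have hn := hR.2.2.2.2.1
  have hB : N * r N / deriv r N < 0 := div_neg_of_pos_of_neg (mul_pos hN (r_pos hR N)) (hn N hN)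
  set B := N * r N / deriv r N with hBdef
  refine ⟨r N / (-B), div_pos (r_pos hR N) (by linarith), fun x hx => ?_⟩
  have h1 : B ≤ x * r x / deriv r x :=
    hanti.antitoneOn (Set.mem_Ioi.2 hx.1) (Set.mem_Ioi.2 hN) hx.2
  have hx' := hn x hx.1
  have h2 : x * r x ≤ B * deriv r x := by
    rw [le_div_iff_of_neg hx'] at h1
    exact h1
  have h3 : r N ≤ r x := (r_anti hR).antitoneOn (Set.mem_Ici.2 hx.1.le) (Set.mem_Ici.2 hN.le) hx.2
  rw [div_mul_eq_mul_div, div_le_iff₀ (by linarith)]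
  nlinarith [hx.1]

lemma smooth1 {r : ℝ → ℝ} (hR2 : AssumptionR2 r) : ContDiff ℝ 3 (deriv r) :=
  ((contDiff_succ_iff_deriv (n := 3)).1 (by simpa [show (3 : WithTop ℕ∞) + 1 = 4 by norm_num] using hR2.1)).2.2

lemma smooth2 {r : ℝ → ℝ} (hR2 : AssumptionR2 r) : ContDiff ℝ 2 (deriv (deriv r)) :=
  ((contDiff_succ_iff_deriv (n := 2)).1 (by simpa [show (2 : WithTop ℕ∞) + 1 = 3 by norm_num] using smooth1 hR2)).2.2

lemma smooth3 {r : ℝ → ℝ} (hR2 : AssumptionR2 r) : ContDiff ℝ 1 (deriv (deriv (deriv r))) :=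
  ((contDiff_succ_iff_deriv (n := 1)).1 (by simpa [show (1 : WithTop ℕ∞) + 1 = 2 by norm_num] using smooth2 hR2)).2.2

lemma deriv_up {r : ℝ → ℝ} (hR : AssumptionR r) (hR2 : AssumptionR2 r) (N : ℝ) :
    ∃ L : ℝ, 0 < L ∧ (∀ x ∈ Set.Icc (-N) N, |deriv r x| ≤ L * |x|) ∧
      ∀ x ∈ Set.Icc (-N) N, ∀ y ∈ Set.Icc (-N) N, |deriv r x - deriv r y| ≤ L * |x - y| := by
  obtain ⟨L, hL, h⟩ := aux_lip (deriv r) ((smooth1 hR2).of_le (by norm_num)) N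
  refine ⟨L, hL, fun x hx => ?_, h⟩
  have hN : 0 ≤ N := by linarith [hx.1, hx.2]
  have := h x hx 0 ⟨by linarith, hN⟩
  rwa [hR.2.2.2.1, sub_zero, sub_zero] at this

lemma taylor {r : ℝ → ℝ} (hr : Differentiable ℝ r) {N L : ℝ} (hL : 0 < L)
    (h : ∀ x ∈ Set.Icc (-N) N, ∀ y ∈ Set.Icc (-N) N, |deriv r x - deriv r y| ≤ L * |x - y|)
    {x y : ℝ} (hx : x ∈ Set.Icc (-N) N) (hy : y ∈ Set.Icc (-N) N) :
    |r x - r y - deriv r y * (x - y)| ≤ L * (x - y) ^ 2 := by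
  have hsub : Set.uIcc y x ⊆ Set.Icc (-N) N := Set.uIcc_subset_Icc hy hx
  have := Convex.norm_image_sub_le_of_norm_hasDerivWithin_le
      (f := fun z => r z - deriv r y * z) (f' := fun z => deriv r z - deriv r y)
      (C := L * |x - y|) (s := Set.uIcc y x) (x := y) (y := x)
      (fun z _ => by
        have h1 := (hr z).hasDerivAt.sub ((hasDerivAt_id z).const_mul (deriv r y))
        simp only [mul_one] at h1
        exact h1.hasDerivWithinAt)
      (fun z hz => by
        rw [Real.norm_eq_abs]
        refine (h z (hsub hz) y hy).trans ?_
        exact mul_le_mul_of_nonneg_left (Set.abs_sub_left_of_mem_uIcc hz) hL.le)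
      (convex_uIcc _ _) Set.left_mem_uIcc Set.right_mem_uIcc
  rw [Real.norm_eq_abs, Real.norm_eq_abs, mul_assoc, abs_mul_abs_self] at this
  calc _ = |r x - deriv r y * x - (r y - deriv r y * y)| := by congr 1; ring
    _ ≤ _ := this
    _ = _ := by ring

lemma k_bound {r : ℝ → ℝ} (hR : AssumptionR r) (hR2 : AssumptionR2 r) (N : ℝ) :
    ∃ L : ℝ, 0 < L ∧ ∀ x ∈ Set.Ioc 0 N, |x * deriv (deriv r) x - deriv r x| ≤ L * x ^ 3 := by
  obtain ⟨L, hL, h⟩ := aux_lip _ (smooth3 hR2) N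
  have hodd3 : deriv (deriv (deriv r)) 0 = 0 := by
    have := deriv_odd_of_even (deriv_even_of_odd (deriv_odd_of_even hR.1)) 0
    rw [neg_zero] at this
    linarith
  refine ⟨L, hL, fun x hx => ?_⟩
  have hN : 0 < N := hx.1.trans_le hx.2
  have := Convex.norm_image_sub_le_of_norm_hasDerivWithin_le
      (f := fun z => z * deriv (deriv r) z - deriv r z)
      (f' := fun z => z * deriv (deriv (deriv r)) z)
      (C := L * x ^ 2) (s := Set.Icc 0 x) (x := 0) (y := x)
      (fun z _ => by
        have d1 : HasDerivAt (deriv r) (deriv (deriv r) z) z :=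
          ((smooth1 hR2).differentiable (by norm_num) z).hasDerivAt
        have d2 : HasDerivAt (deriv (deriv r)) (deriv (deriv (deriv r)) z) z :=
          ((smooth2 hR2).differentiable (by norm_num) z).hasDerivAt
        have h1 := ((hasDerivAt_id z).mul d2).sub d1
        exact (h1.congr_deriv (by simp only [id]; ring)).hasDerivWithinAt)
      (fun z hz => by
        rw [Real.norm_eq_abs, abs_mul, abs_of_nonneg hz.1]
        have h1 := h z ⟨by linarith [hz.1], hz.2.trans hx.2⟩ 0 ⟨by linarith, hN.le⟩
        rw [hodd3, sub_zero, sub_zero, abs_of_nonneg hz.1] at h1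
        calc _ ≤ z * (L * z) := mul_le_mul_of_nonneg_left h1 hz.1
          _ = L * z ^ 2 := by ring
          _ ≤ L * x ^ 2 := by
            have := hz.1
            have := hz.2
            gcongr)
      (convex_Icc _ _) ⟨le_rfl, hx.1.le⟩ ⟨hx.1.le, le_rfl⟩
  simp only [Real.norm_eq_abs, hR.2.2.2.1, zero_mul, sub_zero, abs_of_pos hx.1] at this
  calc _ ≤ _ := this
    _ = _ := by ring

lemma h_sqlip {r : ℝ → ℝ} (hR : AssumptionR r) (hR2 : AssumptionR2 r) {N : ℝ} (hN : 0 < N) :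
    SqLip N (hFun r) := by
  obtain ⟨L, hL, hL1, -⟩ := deriv_up hR hR2 N
  obtain ⟨k, hk, hk1⟩ := k_bound hR hR2 N
  obtain ⟨c, hc, hc1⟩ := deriv_low hR hR2 hN
  have hdiff : Differentiable ℝ r := hR2.1.differentiable (by norm_num)
  have s1 : SqLip N r := SqLip.of_deriv hN hL.le (fun x _ => (hdiff x).hasDerivAt) (fun x hx => by
    have := hL1 x ⟨by linarith [hx.1], hx.2⟩
    rwa [abs_of_pos hx.1] at this)
  have s2 : SqLip N (fun x => x ^ 2) :=
    SqLip.of_deriv (f' := fun x => 2 * x) hN (C := 2) (by norm_num)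
      (fun x _ => by simpa using hasDerivAt_pow 2 x) (fun x hx => by
        rw [abs_of_pos]; linarith [hx.1])
  have s3 : SqLip N (fun x => x / deriv r x) := by
    refine SqLip.of_deriv (f' := fun x => (1 * deriv r x - x * deriv (deriv r) x) / (deriv r x) ^ 2)
      hN (C := k / c ^ 2) (by positivity) (fun x hx => ?_) (fun x hx => ?_)
    · have d1 : HasDerivAt (deriv r) (deriv (deriv r) x) x :=
          ((smooth1 hR2).differentiable (by norm_num) x).hasDerivAt
      exact (hasDerivAt_id x).div d1 (hR.2.2.2.2.1 x hx.1).ne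
    · have h1 := hk1 x hx
      have h2 := hc1 x hx
      have hx0 := hx.1
      have h3 : (c * x) ^ 2 ≤ (deriv r x) ^ 2 := by
        rw [← neg_sq (deriv r x)]; gcongr
      rw [abs_div, abs_sq, one_mul, abs_sub_comm]
      calc _ ≤ k * x ^ 3 / (c * x) ^ 2 := by gcongr
        _ = _ := by field_simp
  refine SqLip.congr ((SqLip.const (-(1 / 2))).mul
    (((s1.mul (s1.mul s1)).mul s3).add (s2.mul (s1.mul s1)))) (fun x hx => ?_)
  rw [hFun, if_neg hx.1.ne']
  ring

lemma hFun_even {r : ℝ → ℝ} (hR : AssumptionR r) (x : ℝ) : hFun r |x| = hFun r x := by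
  rcases abs_choice x with h | h <;> rw [h]
  simp only [hFun, neg_eq_zero, hR.1, deriv_odd_of_even hR.1 x]
  split_ifs
  · rfl
  · rw [neg_mul x, neg_div_neg_eq, neg_sq]

lemma F_even {r : ℝ → ℝ} (hR : AssumptionR r) (x : ℝ) :
    |x| * deriv r |x| / r |x| = x * deriv r x / r x := by
  rcases abs_choice x with h | h <;> rw [h]
  rw [hR.1, deriv_odd_of_even hR.1 x]
  ring

lemma coef {r : ℝ → ℝ} (hR : AssumptionR r) (hR2 : AssumptionR2 r) (hz : r (zZero r) < 1)
    {N K : ℝ} (hN : 0 < N) (hK : 0 < K) :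
    ∃ C : ℝ, 0 < C ∧ ∀ e p : ℝ, 0 < e → |p| ≤ N → r (zZero r) ≤ r p * (1 + K * e) →
      -(C * e * p ^ 2) ≤ 1 + 2 * (p * deriv r p / r p) := by
  set F : ℝ → ℝ := fun z => z * deriv r z / r z with hF
  have hFs : ContDiff ℝ 1 F := by
    refine ContDiff.div (contDiff_id.mul ((smooth1 hR2).of_le (by norm_num)))
      (hR2.1.of_le (by norm_num)) (fun x => (r_pos hR x).ne')
  set z := zZero r with hzdef
  set S := {z : ℝ | z * deriv r z / r z ≥ -(1 / 2)} with hS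
  have hz0 : z ≠ 0 := by
    intro h; rw [h, hR.2.2.1] at hz; exact lt_irrefl _ hz
  have hbdd : BddAbove S := by
    by_contra hb
    exact hz0 (Real.sSup_of_not_bddAbove hb)
  have h0S : (0 : ℝ) ∈ S := by simp [hS]
  have hcl : IsClosed S := isClosed_le continuous_const hFs.continuous
  have hzS : z ∈ S := hcl.csSup_mem ⟨0, h0S⟩ hbdd
  have hzpos : 0 < z := lt_of_le_of_ne (le_csSup hbdd h0S) (Ne.symm hz0)
  have hFz : -(1 / 2) ≤ F z := hzS
  obtain ⟨L, hL, hL1⟩ := aux_lip F hFs N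
  obtain ⟨c, hc, hc1⟩ := deriv_low hR hR2 hN
  refine ⟨2 * L * K / (c * z) / z ^ 2, by positivity, fun e p he hp hrp => ?_⟩
  have hFp : p * deriv r p / r p = F |p| := (F_even hR p).symm
  rw [hFp, ← sq_abs p]
  rw [← r_abs hR p] at hrp
  set x := |p| with hx
  have hx0 : 0 ≤ x := abs_nonneg p
  rcases le_or_gt x z with hxz | hxz
  · have h1 : -(1 / 2) ≤ F x := by
      rcases hx0.eq_or_lt with h | h
      · rw [← h]; simp [hF]
      · exact hFz.trans (hR2.2.2.1.antitoneOn (Set.mem_Ioi.2 h) (Set.mem_Ioi.2 hzpos) hxz)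
    have h2 : 0 ≤ 2 * L * K / (c * z) / z ^ 2 * e * x ^ 2 := by positivity
    linarith
  · have hdiff : Differentiable ℝ r := hR2.1.differentiable (by norm_num)
    obtain ⟨ξ, hξ, hξ'⟩ := exists_deriv_eq_slope r hxz hdiff.continuous.continuousOn
      hdiff.differentiableOn
    have h1 := hc1 ξ ⟨hzpos.trans hξ.1, hξ.2.le.trans hp⟩
    rw [eq_div_iff (by linarith)] at hξ'
    have h2 : c * z * (x - z) ≤ r z - r x := by
      have h3 : c * z ≤ - deriv r ξ := (mul_le_mul_of_nonneg_left hξ.1.le hc.le).trans h1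
      nlinarith
    have h4 : r z - r x ≤ K * e := by
      have : r x * (K * e) ≤ 1 * (K * e) :=
        mul_le_mul_of_nonneg_right (r_le_one hR x) (by positivity)
      linarith
    have h5 : x - z ≤ K * e / (c * z) := by
      rw [le_div_iff₀ (by positivity)]; linarith
    have h6 := hL1 x ⟨by linarith, hp⟩ z ⟨by linarith, by linarith⟩
    rw [abs_of_pos (by linarith : 0 < x - z)] at h6
    have h7 := (abs_le.1 h6).1
    have h8 : L * (x - z) ≤ L * (K * e / (c * z)) := mul_le_mul_of_nonneg_left h5 hL.le
    have h9 : 2 * (L * (K * e / (c * z))) ≤ 2 * L * K / (c * z) / z ^ 2 * e * x ^ 2 := by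
      have e1 : 2 * L * K / (c * z) / z ^ 2 * e * x ^ 2
        = 2 * (L * (K * e / (c * z))) * (x ^ 2 / z ^ 2) := by field_simp
      rw [e1]
      apply le_mul_of_one_le_right (by positivity)
      rw [one_le_div (by positivity)]
      gcongr
    linarith

set_option maxHeartbeats 4000000 in
/-- Tight one-step estimate for `s_t - 1 - h(p_t) η²`. -/
theorem eos_s_tight_contraction_linear (l r : ℝ → ℝ) (δ : ℝ)
    (hL : AssumptionL l)
    (hr0 : r 0 = 1) (hrdef : ∀ x : ℝ, x ≠ 0 → r x = deriv l x / x)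
    (hR : AssumptionR r) (hR2 : AssumptionR2 r)
    (hδ : δ ∈ Set.Ioo 0 (1 - cZero r)) :
    ∀ K : ℝ, 0 < K →
      ∃ η₀ > (0 : ℝ), ∃ C > (0 : ℝ),
        ∀ η : ℝ, 0 < η → η < η₀ →
          ∀ p q : ℕ → ℝ, LinDyn r η p q →
            |p 0| ≤ 1 → q 0 ∈ Set.Ioo (cZero r) (1 - δ) →
            (∀ t : ℕ, q t < 1 → p t ≠ 0) →
            ∀ t : ℕ, q t ≤ 1 →
              |q t / r (p t) - 1| ≤ K * η ^ 2 →
              |q (t + 1) / r (p (t + 1)) - 1 - hFun r (p (t + 1)) * η ^ 2| ≤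
                (1 + 2 * p t * deriv r (p t) / r (p t)) *
                  |q t / r (p t) - 1 - hFun r (p t) * η ^ 2| + C * η ^ 4 * (p t) ^ 2 := by
  intro K hK
  have hpr : ∀ x, |x * r x| ≤ 1 := by
    intro x
    rcases eq_or_ne x 0 with h | h
    · simp [h]
    · rw [hrdef x h, mul_div_cancel₀ _ h]
      have := norm_deriv_le_of_lipschitz (x₀ := x) hL.2.2.1
      simpa using this
  have hrp := r_pos hR
  have hr1 := r_le_one hR
  have hrdiff : Differentiable ℝ r := hR2.1.differentiable (by norm_num)
  have hc0 : cZero r < 1 := by linarith [hδ.1, hδ.2]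
  have hc2 : 1 / 2 ≤ cZero r := le_max_right _ _
  have hc3 : r (zZero r) ≤ cZero r := le_max_left _ _
  obtain ⟨M, hM1, hrM⟩ : ∃ M : ℝ, 1 ≤ M ∧ r M < 1 / 4 := by
    have h1 := hR.2.2.2.2.2.1.eventually (gt_mem_nhds (show (0 : ℝ) < 1 / 4 by norm_num))
    obtain ⟨M, hM⟩ := (h1.and (eventually_ge_atTop 1)).exists
    exact ⟨M, hM.2, hM.1⟩
  have hMpos : 0 < M := by linarith
  have hbound : ∀ x, 1 / 4 ≤ r x → |x| ≤ M := by
    intro x hx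
    by_contra! hcon
    have := r_anti hR (Set.mem_Ici.2 hMpos.le) (Set.mem_Ici.2 (abs_nonneg x)) hcon
    rw [r_abs hR] at this
    linarith
  have hN : 0 < 2 * M := by linarith
  obtain ⟨L0, hL0, hd1, hd2⟩ := deriv_up hR hR2 (2 * M)
  obtain ⟨H, hH, hHb, hHl⟩ := h_sqlip hR hR2 hN
  obtain ⟨Ca, hCa, hcoef⟩ := coef hR hR2 (by linarith) hN hK
  obtain ⟨L, hLdef⟩ : ∃ L, L = 4 * L0 := ⟨_, rfl⟩
  have hLp : 0 < L := by rw [hLdef]; positivity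
  obtain ⟨C1, hC1⟩ : ∃ C1, C1 = 2 * K + 4 * K ^ 2 * L + 2 * L * (4 * K + 1) ^ 2 + 2 * L * (4 * K + 1) :=
    ⟨_, rfl⟩
  obtain ⟨C3, hC3⟩ : ∃ C3, C3 = C1 + (1 + (2 * K + 1) * L) := ⟨_, rfl⟩
  have hC1p : 0 < C1 := by rw [hC1]; positivity
  have hC3p : 0 < C3 := by rw [hC3]; positivity
  obtain ⟨e0, he0⟩ : ∃ e0 : ℝ, e0 = min (1 / 2) (min (1 / (4 * K)) (min (1 / (2 * (4 * K + 1))) (1 / (2 * C3 * M ^ 2)))) := ⟨_, rfl⟩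
  have he0p : 0 < e0 := by rw [he0]; positivity
  refine ⟨e0, he0p, (C1 + K * C3 + 3 * C3 ^ 2 * M ^ 2) + H * (3 * (4 * K + 1)) + 2 * Ca * (K + H),
    by positivity, ?_⟩
  intro η hη hη0 p q hdyn hp0 hq0 _ t hqt hst
  have hηhalf : η < 1 / 2 := hη0.trans_le (by rw [he0]; exact min_le_left _ _)
  have htraj := traj hη (by linarith) hdyn hrp hr1 hpr hp0 (by linarith [hq0.1])
    (by linarith [hq0.2, hδ.1]) t
  have hqc : cZero r < q t := by linarith [hq0.1]
  have hPt := hdyn.1 t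
  have hQt := hdyn.2 t
  generalize p (t + 1) = p' at *
  generalize q (t + 1) = q' at *
  generalize p t = P at *
  generalize q t = Q at *
  obtain ⟨e, he⟩ : ∃ e, e = η ^ 2 := ⟨_, rfl⟩
  have hη4 : η ^ 4 = e ^ 2 := by rw [he]; ring
  rw [hη4, ← he]
  rw [← he] at hst hPt hQt
  have hep : 0 < e := by rw [he]; positivity
  have hee0 : e < e0 := by rw [he]; nlinarith
  have he1 : e ≤ 1 / 2 := hee0.le.trans (by rw [he0]; exact min_le_left _ _)
  have he2 : K * e ≤ 1 / 4 := by
    have : e ≤ 1 / (4 * K) := hee0.le.trans (by rw [he0]; simp)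
    rw [le_div_iff₀ (by positivity)] at this
    linarith
  have he3 : (4 * K + 1) * e ≤ 1 / 2 := by
    have : e ≤ 1 / (2 * (4 * K + 1)) := hee0.le.trans (by
      rw [he0]; exact (min_le_right _ _).trans ((min_le_right _ _).trans (min_le_left _ _)))
    rw [le_div_iff₀ (by positivity)] at this
    linarith
  have he4 : C3 * e * M ^ 2 ≤ 1 / 2 := by
    have : e ≤ 1 / (2 * C3 * M ^ 2) := hee0.le.trans (by
      rw [he0]; exact (min_le_right _ _).trans ((min_le_right _ _).trans (min_le_right _ _)))
    rw [le_div_iff₀ (by positivity)] at this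
    linarith
  rcases eq_or_ne P 0 with hP0 | hP0
  · subst hP0
    have e1 : p' = 0 := by rw [hPt]; ring
    have e2 : q' = Q := by rw [hQt]; simp
    rw [e1, e2]
    simp
  obtain ⟨σ, hσdef⟩ : ∃ σ, σ = Q / r P - 1 := ⟨_, rfl⟩
  have hs : Q / r P = 1 + σ := by rw [hσdef]; ring
  have hQr : Q = (1 + σ) * r P := by rw [← hs, div_mul_cancel₀ _ (hrp P).ne']
  rw [← hσdef] at hst
  rw [← hσdef]
  have hσ' := abs_le.1 hst
  have hs0 : 0 < 1 + σ := by linarith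
  have hrP := hrp P
  have hrP4 : 1 / 4 ≤ r P := by
    have := mul_le_mul_of_nonneg_right (show 1 + σ ≤ 2 by linarith) hrP.le
    linarith
  have hPM := hbound P hrP4
  have hPN : |P| ≤ 2 * M := by linarith
  have hPsq : P ^ 2 ≤ M ^ 2 := by rw [← sq_abs]; gcongr
  have hX1 : P ^ 2 * r P ^ 2 ≤ 1 := by
    rw [← mul_pow, ← sq_abs]
    exact pow_le_one₀ (abs_nonneg _) (hpr P)
  have hX0 : 0 ≤ P ^ 2 * r P ^ 2 := by positivity
  obtain ⟨ε, hε⟩ : ∃ ε, ε = 2 - 2 / (1 + σ) + e * (P ^ 2 * r P ^ 2) := ⟨_, rfl⟩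
  have hεb : |ε| ≤ (4 * K + 1) * e := by
    have e1 : ε = 2 * σ / (1 + σ) + e * (P ^ 2 * r P ^ 2) := by rw [hε]; field_simp; ring
    rw [e1]
    refine (abs_add_le _ _).trans ?_
    have h1 : |2 * σ / (1 + σ)| ≤ 4 * K * e := by
      rw [abs_div, abs_mul, abs_two, abs_of_pos hs0, div_le_iff₀ hs0]
      have : 4 * K * e * (1 / 2) ≤ 4 * K * e * (1 + σ) :=
        mul_le_mul_of_nonneg_left (by linarith) (by positivity)
      linarith
    have h2 : |e * (P ^ 2 * r P ^ 2)| ≤ e := by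
      rw [abs_of_nonneg (by positivity)]; exact mul_le_of_le_one_right hep.le hX1
    linarith
  have hεh := abs_le.1 (hεb.trans he3)
  have hp' : p' = -((1 - ε) * P) := by
    have : 2 * r P / Q = 2 / (1 + σ) := by rw [hQr]; field_simp
    rw [hPt, this, hε]; ring
  have hPabs : 0 < |P| := abs_pos.2 hP0
  have hp'abs : |p'| = (1 - ε) * |P| := by
    rw [hp', abs_neg, abs_mul, abs_of_pos (by linarith)]
  have hp'N : |p'| ≤ 2 * M := by
    rw [hp'abs]
    have := mul_le_mul_of_nonneg_right (show 1 - ε ≤ 2 by linarith) hPabs.le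
    linarith
  have hp'pos : 0 < |p'| := by rw [hp'abs]; apply mul_pos _ hPabs; linarith
  obtain ⟨A, hA⟩ : ∃ A, A = P * deriv r P / r P := ⟨_, rfl⟩
  have hAb : |A| ≤ L * P ^ 2 := by
    rw [hA, abs_div, abs_mul, abs_of_pos hrP, div_le_iff₀ hrP]
    have h1 := hd1 P (abs_le.1 hPN)
    calc |P| * |deriv r P| ≤ |P| * (L0 * |P|) := by gcongr
      _ = L0 * P ^ 2 := by rw [← sq_abs]; ring
      _ = L * P ^ 2 * (1 / 4) := by rw [hLdef]; ring
      _ ≤ _ := by gcongr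
  have hrp' : r p' = r ((1 - ε) * P) := by rw [hp', hR.1]
  have hw : |r p' / r P - 1 + ε * A| ≤ L * ε ^ 2 * P ^ 2 := by
    have hmem : (1 - ε) * P ∈ Set.Icc (-(2 * M)) (2 * M) := by
      apply abs_le.1; rw [hp', abs_neg] at hp'N; exact hp'N
    have h1 := taylor hrdiff hL0 hd2 hmem (abs_le.1 hPN)
    have e1 : r p' / r P - 1 + ε * A
        = (r ((1 - ε) * P) - r P - deriv r P * ((1 - ε) * P - P)) / r P := by
      rw [hrp', hA]; field_simp; ring
    rw [e1, abs_div, abs_of_pos hrP, div_le_iff₀ hrP]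
    calc _ ≤ _ := h1
      _ = L * ε ^ 2 * P ^ 2 * (1 / 4) := by rw [hLdef]; ring
      _ ≤ _ := by gcongr
  have hcore := core hK hLp hep he1 he2 hPsq (pow_le_one₀ hrP.le (hr1 P)) hX1 hst hε hAb hεb hw
    hC1 hC3 he4
  have hs' : q' / r p' = (1 + σ) / ((1 - e * (P ^ 2 * r P ^ 2) * (1 + 2 * σ)) * (r p' / r P)) := by
    have e1 : 1 - e * P ^ 2 * r P * (2 * Q - r P) = 1 - e * (P ^ 2 * r P ^ 2) * (1 + 2 * σ) := by
      rw [hQr]; ring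
    rw [hQt, e1, hQr, div_eq_mul_inv, div_eq_mul_inv, div_eq_mul_inv, mul_inv, mul_inv, inv_inv]
    ring
  rw [← hs'] at hcore
  have hh : |hFun r P - hFun r p'| ≤ H * (3 * (4 * K + 1)) * (e * P ^ 2) := by
    rw [← hFun_even hR P, ← hFun_even hR p']
    refine (hHl _ ⟨hPabs, hPN⟩ _ ⟨hp'pos, hp'N⟩).trans ?_
    have e1 : |P| ^ 2 - |p'| ^ 2 = ε * (2 - ε) * P ^ 2 := by
      rw [hp'abs, mul_pow, sq_abs]; ring
    have h2 : |2 - ε| ≤ 3 := by rw [abs_le]; constructor <;> linarith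
    rw [e1, abs_mul, abs_mul, abs_of_nonneg (sq_nonneg P)]
    calc H * (|ε| * |2 - ε| * P ^ 2) ≤ H * ((4 * K + 1) * e * 3 * P ^ 2) := by gcongr
      _ = _ := by ring
  have hhb : |hFun r P| ≤ H := by
    rw [← hFun_even hR P]; exact hHb _ ⟨hPabs, hPN⟩
  have hdP : deriv r P ≠ 0 := by
    intro h0
    obtain ⟨c, hc, hc1⟩ := deriv_low hR hR2 hN
    have h1 := hR.2.2.2.2.1 |P| hPabs
    rcases abs_choice P with h | h <;> rw [h] at h1
    · linarith
    · rw [deriv_odd_of_even hR.1] at h1; linarith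
  have hfix : 2 * A * hFun r P = -(P ^ 2 * r P ^ 2 + P ^ 2 * r P ^ 2 * A) := by
    rw [hFun, if_neg hP0, hA]; field_simp
  have hca := hcoef e P hep hPN (by
    have h1 : (1 + σ) * r P ≤ r P * (1 + K * e) := by
      rw [mul_comm]
      exact mul_le_mul_of_nonneg_left (by linarith) hrP.le
    linarith)
  rw [← hA] at hca
  have hcoe : 1 + 2 * P * deriv r P / r P = 1 + 2 * A := by rw [hA]; ring
  rw [hcoe]
  obtain ⟨D, hD⟩ : ∃ D, D = σ - hFun r P * e := ⟨_, rfl⟩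
  rw [← hD]
  have hDb : |D| ≤ (K + H) * e := by
    rw [hD]
    refine (abs_sub _ _).trans ?_
    rw [abs_mul, abs_of_pos hep]
    have := mul_le_mul_of_nonneg_right hhb hep.le
    linarith
  have hsplit : q' / r p' - 1 - hFun r p' * e = (1 + 2 * A) * D
      + (q' / r p' - 1 - σ - (e * (P ^ 2 * r P ^ 2) + (2 * σ + e * (P ^ 2 * r P ^ 2)) * A))
      + (hFun r P - hFun r p') * e := by
    rw [hD]; linear_combination e * hfix
  rw [hsplit]
  have f1 : |(1 + 2 * A) * D| ≤ (1 + 2 * A) * |D| + 2 * Ca * (K + H) * (e ^ 2 * P ^ 2) := by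
    rw [abs_mul]
    have h0 : 0 ≤ Ca * e * P ^ 2 := by positivity
    have h1 : |1 + 2 * A| ≤ (1 + 2 * A) + 2 * (Ca * e * P ^ 2) := by
      rw [abs_le]; constructor <;> linarith
    calc |1 + 2 * A| * |D| ≤ ((1 + 2 * A) + 2 * (Ca * e * P ^ 2)) * |D| := by gcongr
      _ = (1 + 2 * A) * |D| + 2 * (Ca * e * P ^ 2) * |D| := by ring
      _ ≤ (1 + 2 * A) * |D| + 2 * (Ca * e * P ^ 2) * ((K + H) * e) := by gcongr
      _ = _ := by ring
  have f2 : |(hFun r P - hFun r p') * e| ≤ H * (3 * (4 * K + 1)) * (e ^ 2 * P ^ 2) := by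
    rw [abs_mul, abs_of_pos hep]
    calc _ ≤ H * (3 * (4 * K + 1)) * (e * P ^ 2) * e := by gcongr
      _ = _ := by ring
  refine (abs_add_le _ _).trans ?_
  refine (add_le_add (abs_add_le _ _) le_rfl).trans ?_
  linarith
end
end

section
/- Let ℓ satisfy Assumption (L), let r(p) = ℓ'(p)/p for p ≠ 0 and r(0) = 1 satisfy Assumptions (R) and (R2). Define h : ℝ → ℝ by h(p) = -(1/2)(p·r(p)³/r'(p) + p² r(p)²) for p ≠ 0 and h(0) = -1/(2r''(0)). Then h is positive everywhere, even, bounded on ℝ, and twice continuously differentiable. -/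
open Filter
open scoped Classical

noncomputable section

theorem aux_contDiff_integral (n : ℕ) : ∀ (k : ℕ) (u : ℝ → ℝ), ContDiff ℝ n u →
    ContDiff ℝ n (fun x => ∫ t in (0:ℝ)..1, t ^ k * u (t * x)) := by
  induction n with
  | zero =>
    intro k u hu
    have hu' : Continuous u := hu.continuous
    have : Continuous (fun x => ∫ t in (0:ℝ)..1, t ^ k * u (t * x)) := by
      apply intervalIntegral.continuous_parametric_intervalIntegral_of_continuous'
      simp only [Function.uncurry_def]
      fun_prop
    exact_mod_cast contDiff_zero.2 this
  | succ n ih =>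
    intro k u hu
    have hu2 : ContDiff ℝ ((n : WithTop ℕ∞) + 1) u := by exact_mod_cast hu
    have hdu := (contDiff_succ_iff_deriv.1 hu2)
    have hd : Differentiable ℝ u := hdu.1
    have hd' : ContDiff ℝ n (deriv u) := hdu.2.2
    have hcu : Continuous u := hd.continuous
    have hcd : Continuous (deriv u) := hd'.continuous
    have key : ∀ x₀, HasDerivAt (fun x => ∫ t in (0:ℝ)..1, t ^ k * u (t * x))
        (∫ t in (0:ℝ)..1, t ^ (k+1) * deriv u (t * x₀)) x₀ := by
      intro x₀
      obtain ⟨C, hC⟩ := (isCompact_Icc (a := -(|x₀| + 1)) (b := |x₀| + 1)).exists_bound_of_continuousOn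
        hcd.continuousOn
      refine (intervalIntegral.hasDerivAt_integral_of_dominated_loc_of_deriv_le
        (F := fun x t => t ^ k * u (t * x)) (F' := fun x t => t ^ (k+1) * deriv u (t * x))
        (bound := fun _ => C) (Metric.ball_mem_nhds x₀ one_pos) ?_ ?_ ?_ ?_ ?_ ?_).2
      · refine Eventually.of_forall fun x => ?_
        exact Continuous.aestronglyMeasurable (by fun_prop)
      · exact Continuous.intervalIntegrable (by fun_prop) _ _
      · exact Continuous.aestronglyMeasurable (by fun_prop)
      · refine Eventually.of_forall fun t ht x hx => ?_
        rw [Set.uIoc_of_le zero_le_one] at ht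
        have hx1 : |x| ≤ |x₀| + 1 := by
          have h1 : |x - x₀| < 1 := by simpa [Real.dist_eq] using hx
          have h2 := abs_sub_abs_le_abs_sub x x₀
          linarith
        have htx : |t * x| ≤ |x₀| + 1 := by
          rw [abs_mul, abs_of_pos ht.1]
          nlinarith [ht.1, ht.2, abs_nonneg x]
        have h3 := hC (t * x) (Set.mem_Icc.2 (abs_le.1 htx))
        rw [norm_mul]
        have h4 : ‖t ^ (k+1)‖ ≤ 1 := by
          rw [norm_pow, Real.norm_eq_abs, abs_of_pos ht.1]
          exact pow_le_one₀ ht.1.le ht.2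
        nlinarith [norm_nonneg (deriv u (t * x))]
      · exact intervalIntegrable_const
      · refine Eventually.of_forall fun t ht x hx => ?_
        have h1 : HasDerivAt (fun x => u (t * x)) (deriv u (t * x) * t) x := by
          have h2 : HasDerivAt (fun x : ℝ => t * x) t x := by
            simpa using (hasDerivAt_id x).const_mul t
          exact (hd (t * x)).hasDerivAt.comp x h2
        have := h1.const_mul (t ^ k)
        have he : t ^ (k+1) * deriv u (t * x) = t ^ k * (deriv u (t * x) * t) := by ring
        simp only [he]
        exact this
    have : ContDiff ℝ ((n : WithTop ℕ∞) + 1) (fun x => ∫ t in (0:ℝ)..1, t ^ k * u (t * x)) := by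
      rw [contDiff_succ_iff_deriv]
      refine ⟨fun x => (key x).differentiableAt, by simp, ?_⟩
      have he : deriv (fun x => ∫ t in (0:ℝ)..1, t ^ k * u (t * x)) =
          fun x => ∫ t in (0:ℝ)..1, t ^ (k+1) * deriv u (t * x) := by
        ext x; exact (key x).deriv
      rw [he]
      exact ih (k+1) _ hd'
    exact_mod_cast this

theorem aux_hadamard (f : ℝ → ℝ) (hf : ContDiff ℝ 3 f) (h0 : f 0 = 0) :
    ∃ g : ℝ → ℝ, ContDiff ℝ 2 g ∧ (∀ x, f x = x * g x) ∧ g 0 = deriv f 0 := by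
  have hf2 : ContDiff ℝ ((2 : WithTop ℕ∞) + 1) f := by
    convert hf using 1; norm_num
  have hdf := contDiff_succ_iff_deriv.1 hf2
  refine ⟨fun x => ∫ t in (0:ℝ)..1, t ^ 0 * deriv f (t * x), ?_, ?_, ?_⟩
  · exact_mod_cast aux_contDiff_integral 2 0 _ (by exact_mod_cast hdf.2.2)
  · intro x
    simp only [pow_zero, one_mul]
    rw [intervalIntegral.mul_integral_comp_mul_right, intervalIntegral.integral_deriv_eq_sub]
    · simp [h0]
    · intro y _; exact hdf.1 y
    · exact hdf.2.2.continuous.intervalIntegrable _ _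
  · simp

/-- Properties of the function `h`: positive, even, bounded, and `C²`. -/
theorem hFun_properties (l r : ℝ → ℝ)
    (hL : AssumptionL l)
    (hr0 : r 0 = 1) (hrdef : ∀ x : ℝ, x ≠ 0 → r x = deriv l x / x)
    (hR : AssumptionR r) (hR2 : AssumptionR2 r) :
    (∀ p : ℝ, 0 < hFun r p) ∧
    (∀ p : ℝ, hFun r (-p) = hFun r p) ∧
    (∃ M : ℝ, ∀ p : ℝ, |hFun r p| ≤ M) ∧
    ContDiff ℝ 2 (hFun r) := by
  obtain ⟨hconv, -, hlip, hld, hldd, -⟩ := hL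
  obtain ⟨heven, hC1, -, hd0, hneg, htop, -⟩ := hR
  obtain ⟨hC4, -, hA, -, hB, -⟩ := hR2
  have hdiff : Differentiable ℝ r := hC1.differentiable (by norm_num)
  have hC41 : ContDiff ℝ ((3 : WithTop ℕ∞) + 1) r := by
    convert hC4 using 1; norm_num
  have hC3 : ContDiff ℝ 3 (deriv r) := (contDiff_succ_iff_deriv.1 hC41).2.2
  -- r is strictly decreasing on [0, ∞), positive
  have hanti : StrictAntiOn r (Set.Ici 0) := by
    apply strictAntiOn_of_deriv_neg (convex_Ici 0) hdiff.continuous.continuousOn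
    intro x hx
    rw [interior_Ici] at hx
    exact hneg x hx
  have hpos0 : ∀ p, 0 ≤ p → 0 < r p := by
    intro p hp
    have h1 : r (p + 1) < r p := hanti hp (by simp; linarith) (by linarith)
    have h2 : 0 ≤ r (p + 1) := by
      apply le_of_tendsto htop
      filter_upwards [eventually_ge_atTop (p + 1)] with x hx
      exact hanti.antitoneOn (by simp; linarith) (by simp; linarith) hx
    linarith
  have hle1 : ∀ p, 0 ≤ p → r p ≤ 1 := by
    intro p hp
    rw [← hr0]
    exact hanti.antitoneOn (by simp) hp hp
  have hpos : ∀ p, 0 < r p := by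
    intro p
    rcases le_total 0 p with h | h
    · exact hpos0 p h
    · rw [← heven]; exact hpos0 _ (by linarith)
  -- odd derivative
  have hodd : ∀ p, deriv r (-p) = - deriv r p := by
    intro p
    have h1 : (fun x => r (-x)) = r := funext heven
    have h2 := deriv_comp_neg r p
    rw [h1] at h2
    linarith
  have hne : ∀ p, p ≠ 0 → deriv r p ≠ 0 := by
    intro p hp
    rcases lt_or_gt_of_ne hp with h | h
    · have := hneg (-p) (by linarith)
      rw [hodd] at this
      intro h'; rw [h'] at this; simp at this
    · exact (hneg p h).ne
  -- evenness
  have hE : ∀ p : ℝ, hFun r (-p) = hFun r p := by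
    intro p
    unfold hFun
    by_cases hp : p = 0
    · simp [hp]
    · rw [if_neg hp, if_neg (neg_ne_zero.2 hp), heven, hodd]
      rw [neg_mul p, neg_div_neg_eq, neg_sq]
  -- derivative of l
  have hdl : ∀ p, 0 < p → deriv l p = p * r p := by
    intro p hp
    rw [hrdef p hp.ne']; field_simp
  have hpr1 : ∀ p, 0 < p → p * r p ≤ 1 := by
    intro p hp
    have h1 := norm_deriv_le_of_lipschitz (x₀ := p) hlip
    rw [hdl p hp] at h1
    exact (le_abs_self _).trans (by simpa using h1)
  have hmono : Monotone (deriv l) := by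
    have := hconv.monotoneOn_deriv (fun x _ => hld x)
    exact monotoneOn_univ.1 this
  have hge : ∀ p, 0 < p → 0 ≤ r p + p * deriv r p := by
    intro p hp
    have h1 : HasDerivAt (fun x => x * r x) (1 * r p + p * deriv r p) p :=
      (hasDerivAt_id p).mul (hdiff p).hasDerivAt
    have h2 : deriv l =ᶠ[nhds p] fun x => x * r x := by
      filter_upwards [lt_mem_nhds hp] with x hx using hdl x hx
    have h3 := (h1.congr_of_eventuallyEq h2).deriv
    have h4 : 0 ≤ deriv (deriv l) p := hmono.deriv_nonneg
    rw [h3] at h4; linarith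
  have hgt : ∀ p, 0 < p → 0 < r p + p * deriv r p := by
    intro p hp
    have h1 := hA (Set.mem_Ioi.2 hp) (Set.mem_Ioi.2 (by linarith : 0 < p + 1)) (by linarith)
    simp only at h1
    have h2 := hge (p + 1) (by linarith)
    have h3 : -1 ≤ (p + 1) * deriv r (p + 1) / r (p + 1) := by
      rw [le_div_iff₀ (hpos _)]; linarith
    have h4 : -1 < p * deriv r p / r p := by linarith
    rw [lt_div_iff₀ (hpos _)] at h4; linarith
  -- Hadamard
  obtain ⟨g, hg2, hgr, hg0⟩ := aux_hadamard (deriv r) hC3 hd0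
  -- bound near zero
  have hc : 0 < r 1 / (-deriv r 1) := div_pos (hpos 1) (by linarith [hneg 1 one_pos])
  set c := r 1 / (-deriv r 1) with hcdef
  have hnear : ∀ p, 0 < p → p ≤ 1 → p * r p / (-deriv r p) ≤ c := by
    intro p hp hp1
    have := hB.antitoneOn (Set.mem_Ioi.2 hp) (Set.mem_Ioi.2 one_pos) hp1
    simp only [one_mul] at this
    rw [hcdef, div_neg, div_neg]; linarith
  have hg0neg : g 0 < 0 := by
    have h1 : ∀ p ∈ Set.Ioc (0:ℝ) 1, g p ≤ - (r p / c) := by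
      intro p hp
      have h2 := hnear p hp.1 hp.2
      rw [div_le_iff₀ (by linarith [hneg p hp.1]), hgr] at h2
      have h3 : p * r p ≤ p * (c * -g p) := by linarith
      have h4 := le_of_mul_le_mul_left h3 hp.1
      have h5 : r p / c ≤ - g p := by
        rw [div_le_iff₀ hc]; linarith
      linarith
    have h2 : g 0 ≤ -(r 0 / c) := by
      have t1 : Tendsto g (nhdsWithin 0 (Set.Ioi 0)) (nhds (g 0)) :=
        (hg2.continuous.tendsto 0).mono_left nhdsWithin_le_nhds
      have t2 : Tendsto (fun p => -(r p / c)) (nhdsWithin 0 (Set.Ioi 0)) (nhds (-(r 0 / c))) :=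
        (((hdiff.continuous.div_const c).neg).tendsto 0).mono_left nhdsWithin_le_nhds
      apply le_of_tendsto_of_tendsto t1 t2
      filter_upwards [Ioc_mem_nhdsGT (zero_lt_one' ℝ)] with p hp using h1 p hp
    have : 0 < r 0 / c := div_pos (hpos 0) hc
    linarith
  have hgne : ∀ p, g p ≠ 0 := by
    intro p
    by_cases hp : p = 0
    · rw [hp]; exact hg0neg.ne
    · intro h
      apply hne p hp
      rw [hgr, h, mul_zero]
  have hform : hFun r = fun p => -(1/2) * (r p ^ 3 / g p + p ^ 2 * r p ^ 2) := by
    ext p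
    unfold hFun
    by_cases hp : p = 0
    · rw [if_pos hp, hp, hr0, hg0]
      have : deriv (deriv r) 0 ≠ 0 := by rw [← hg0]; exact hg0neg.ne
      field_simp
      norm_num
    · rw [if_neg hp, hgr p]
      have := hgne p
      field_simp
  have hP0 : ∀ p, 0 < p → 0 < hFun r p ∧ hFun r p ≤ 1/2 * (p * r p ^ 3 / (- deriv r p)) := by
    intro p hp
    unfold hFun
    rw [if_neg hp.ne', div_neg]
    have h1 := hneg p hp
    constructor
    · have h2 : -(1 / 2) * (p * r p ^ 3 / deriv r p + p ^ 2 * r p ^ 2) =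
          1/2 * (p * r p ^ 2 * (r p + p * deriv r p) / (- deriv r p)) := by
        have := h1.ne
        field_simp
      rw [h2]
      have h3 := hgt p hp
      have h4 := hpos p
      have h5 : 0 < - deriv r p := by linarith
      positivity
    · have : 0 ≤ p ^ 2 * r p ^ 2 := by positivity
      linarith
  have hzero : 0 < hFun r 0 := by
    rw [hform]; simp only [hr0]
    have : (1:ℝ) ^ 3 / g 0 < 0 := by
      rw [one_pow]; exact one_div_neg.2 hg0neg
    linarith
  have hP : ∀ p : ℝ, 0 < hFun r p := by
    intro p
    rcases lt_trichotomy p 0 with h | h | h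
    · rw [← hE]; exact (hP0 _ (by linarith)).1
    · rw [h]; exact hzero
    · exact (hP0 p h).1
  refine ⟨hP, hE, ?_, ?_⟩
  · have hb : ∀ p, 0 < p → hFun r p ≤ c := by
      intro p hp
      have h0 := hneg p hp
      have h5 : 0 < - deriv r p := by linarith
      have h1 : p * r p ^ 3 / (- deriv r p) ≤ c := by
        rcases le_total p 1 with h | h
        · have h2 := hnear p hp h
          have h3 : p * r p ^ 3 / (- deriv r p) = p * r p / (- deriv r p) * r p ^ 2 := by ring
          have h4 : r p ^ 2 ≤ 1 := pow_le_one₀ (hpos p).le (hle1 p hp.le)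
          rw [h3]
          calc _ ≤ c * 1 := by
                apply mul_le_mul h2 h4 (by positivity) hc.le
            _ = c := mul_one c
        · have h2 := hA.antitoneOn (Set.mem_Ioi.2 one_pos) (Set.mem_Ioi.2 hp) h
          simp only [one_mul] at h2
          have hr1 := hneg 1 one_pos
          have h3 : r p ≤ c * (p * -deriv r p) := by
            rw [div_le_div_iff₀ (hpos p) (hpos 1)] at h2
            rw [hcdef, div_mul_eq_mul_div, le_div_iff₀ (by linarith)]
            linarith
          rw [div_le_iff₀ h5]
          have h4 := hpr1 p hp
          have h6 : 0 < p * r p := mul_pos hp (hpos p)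
          have h7 : (p * r p) ^ 2 ≤ 1 := pow_le_one₀ h6.le h4
          have h8 : p * r p ^ 3 ≤ (p * r p) ^ 2 * (c * -deriv r p) := by
            calc p * r p ^ 3 = p * r p ^ 2 * r p := by ring
              _ ≤ p * r p ^ 2 * (c * (p * -deriv r p)) :=
                  mul_le_mul_of_nonneg_left h3 (by positivity)
              _ = _ := by ring
          have h9 : 0 < c * -deriv r p := mul_pos hc h5
          nlinarith
      have := (hP0 p hp).2
      linarith
    refine ⟨max c (hFun r 0), fun p => ?_⟩
    rw [abs_of_pos (hP p)]
    rcases lt_trichotomy p 0 with h | h | h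
    · rw [← hE]; exact (hb _ (by linarith)).trans (le_max_left _ _)
    · rw [h]; exact le_max_right _ _
    · exact (hb p h).trans (le_max_left _ _)
  · rw [hform]
    have hr2 : ContDiff ℝ 2 r := hC4.of_le (by norm_num)
    exact contDiff_const.mul (((hr2.pow 3).div hg2 hgne).add ((contDiff_id.pow 2).mul (hr2.pow 2)))
end
end

section
/- Let ℓ : ℝ → ℝ be convex, even, 1-Lipschitz, and twice differentiable with ℓ''(0) = 1. Let x ∈ ℝ^d with ‖x‖₂ = 1 and consider L(U, v) = ℓ(vᵀUx) on ℝ^{m×d} × ℝ^m. Then for every (U, v), the largest eigenvalue λ_max(∇²L(U, v)) of the Hessian of L at (U, v) satisfies |λ_max(∇²L(U, v)) − ℓ''(vᵀUx)·(‖Ux‖₂² + ‖v‖₂²)| ≤ 1. -/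
open Filter
open scoped Classical

noncomputable section

open Matrix

/-- The largest eigenvalue of the Hessian of `L` at `(U, v)`, defined as the supremum of the
second directional derivatives (the Rayleigh quotient) over the Euclidean unit sphere of the
parameter space `ℝ^{m×d} × ℝ^m`. -/
def lamMax (m d : ℕ) (L : Matrix (Fin m) (Fin d) ℝ → (Fin m → ℝ) → ℝ)
    (U : Matrix (Fin m) (Fin d) ℝ) (v : Fin m → ℝ) : ℝ :=
  sSup {c : ℝ | ∃ (A : Matrix (Fin m) (Fin d) ℝ) (w : Fin m → ℝ),
    ((∑ i, ∑ j, (A i j) ^ 2) + ∑ i, (w i) ^ 2 = 1) ∧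
    iteratedDeriv 2 (fun s : ℝ => L (U + s • A) (v + s • w)) 0 = c}

lemma aux_second_deriv (l : ℝ → ℝ) (h1 : ∀ x, DifferentiableAt ℝ l x)
    (h2 : ∀ x, DifferentiableAt ℝ (deriv l) x) (a b c : ℝ) :
    iteratedDeriv 2 (fun s : ℝ => l (a + b * s + c * s ^ 2)) 0
      = deriv (deriv l) a * b ^ 2 + deriv l a * (2 * c) := by
  have hf : ∀ s : ℝ, HasDerivAt (fun s : ℝ => a + b * s + c * s ^ 2) (b + 2 * c * s) s := by
    intro s
    have := (((hasDerivAt_id s).const_mul b).const_add a).add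
      (((hasDerivAt_id s).pow 2).const_mul c)
    refine this.congr_deriv ?_
    simp
    ring
  have hg : deriv (fun s : ℝ => l (a + b * s + c * s ^ 2))
      = fun s => deriv l (a + b * s + c * s ^ 2) * (b + 2 * c * s) := by
    funext s
    exact ((h1 _).hasDerivAt.comp s (hf s)).deriv
  rw [iteratedDeriv_succ, iteratedDeriv_one, hg]
  have hb : HasDerivAt (fun s : ℝ => b + 2 * c * s) (2 * c) 0 := by
    simpa using ((hasDerivAt_id (0 : ℝ)).const_mul (2 * c)).const_add b
  have := (((h2 (a + b * 0 + c * 0 ^ 2)).hasDerivAt.comp 0 (hf 0))).mul hb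
  refine this.deriv.trans ?_
  simp
  ring

lemma aux_expand {m d : ℕ} (l : ℝ → ℝ) (h1 : ∀ x, DifferentiableAt ℝ l x)
    (h2 : ∀ x, DifferentiableAt ℝ (deriv l) x) (x : Fin d → ℝ)
    (U A : Matrix (Fin m) (Fin d) ℝ) (v w : Fin m → ℝ) :
    iteratedDeriv 2 (fun s : ℝ => l ((v + s • w) ⬝ᵥ (U + s • A).mulVec x)) 0
      = deriv (deriv l) (v ⬝ᵥ U.mulVec x) * (w ⬝ᵥ U.mulVec x + v ⬝ᵥ A.mulVec x) ^ 2
        + deriv l (v ⬝ᵥ U.mulVec x) * (2 * (w ⬝ᵥ A.mulVec x)) := by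
  rw [← aux_second_deriv l h1 h2]
  congr 1
  funext s
  congr 1
  simp only [Matrix.add_mulVec, Matrix.smul_mulVec, dotProduct_add, add_dotProduct,
    smul_dotProduct, dotProduct_smul, smul_eq_mul]
  ring

lemma aux_cs {m : ℕ} (w p v q : Fin m → ℝ) :
    (w ⬝ᵥ p + v ⬝ᵥ q) ^ 2
      ≤ ((∑ i, q i ^ 2) + ∑ i, w i ^ 2) * ((∑ i, p i ^ 2) + ∑ i, v i ^ 2) := by
  have := Finset.sum_mul_sq_le_sq_mul_sq Finset.univ (Sum.elim w q) (Sum.elim p v)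
  simp only [Fintype.sum_sum_type, Sum.elim_inl, Sum.elim_inr] at this
  have e : v ⬝ᵥ q = ∑ i, q i * v i := by rw [dotProduct_comm]; rfl
  rw [e, add_comm (∑ i, q i ^ 2)]
  exact this

lemma aux_cross {m : ℕ} (w q : Fin m → ℝ) :
    |2 * (w ⬝ᵥ q)| ≤ (∑ i, q i ^ 2) + ∑ i, w i ^ 2 := by
  simp only [dotProduct, Finset.mul_sum, ← Finset.sum_add_distrib]
  refine (Finset.abs_sum_le_sum_abs _ _).trans (Finset.sum_le_sum fun i _ => ?_)
  rw [abs_le]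
  constructor <;> nlinarith [sq_nonneg (w i - q i), sq_nonneg (w i + q i)]

lemma aux_mulVec {m d : ℕ} (A : Matrix (Fin m) (Fin d) ℝ) (x : Fin d → ℝ)
    (hx : ∑ j, (x j) ^ 2 = 1) : ∑ i, (A.mulVec x i) ^ 2 ≤ ∑ i, ∑ j, (A i j) ^ 2 := by
  refine Finset.sum_le_sum fun i _ => ?_
  have := Finset.sum_mul_sq_le_sq_mul_sq Finset.univ (A i) x
  rw [hx, mul_one] at this
  exact this

/-- The sharpness of `L(U,v) = l(vᵀUx)` is within `1` of `l''(vᵀUx)(‖Ux‖² + ‖v‖²)`. -/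
theorem sharpness_bound_linear (m d : ℕ) (l : ℝ → ℝ)
    (hL : AssumptionL l)
    (x : Fin d → ℝ) (hx : ∑ j, (x j) ^ 2 = 1)
    (U : Matrix (Fin m) (Fin d) ℝ) (v : Fin m → ℝ) :
    |lamMax m d (fun M w => l (w ⬝ᵥ M.mulVec x)) U v -
      deriv (deriv l) (v ⬝ᵥ U.mulVec x) * ((∑ i, (U.mulVec x i) ^ 2) + ∑ i, (v i) ^ 2)| ≤ 1 := by
  obtain ⟨hc, -, hlip, h1, h2, -⟩ := hL
  have hmono : Monotone (deriv l) := by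
    have := hc.monotoneOn_deriv (fun x _ => h1 x)
    exact monotoneOn_univ.mp this
  have hl2 : 0 ≤ deriv (deriv l) (v ⬝ᵥ U.mulVec x) := hmono.deriv_nonneg
  have hl1 : |deriv l (v ⬝ᵥ U.mulVec x)| ≤ 1 := by
    simpa using norm_deriv_le_of_lipschitz (x₀ := v ⬝ᵥ U.mulVec x) hlip
  unfold lamMax
  set S : Set ℝ := {c : ℝ | ∃ (A : Matrix (Fin m) (Fin d) ℝ) (w : Fin m → ℝ),
    ((∑ i, ∑ j, (A i j) ^ 2) + ∑ i, (w i) ^ 2 = 1) ∧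
    iteratedDeriv 2 (fun s : ℝ => (fun (M : Matrix (Fin m) (Fin d) ℝ) (w : Fin m → ℝ) =>
      l (w ⬝ᵥ M.mulVec x)) (U + s • A) (v + s • w)) 0 = c} with hS
  set p := U.mulVec x with hp
  set N := (∑ i, p i ^ 2) + ∑ i, v i ^ 2 with hN
  set D := deriv (deriv l) (v ⬝ᵥ p) with hD
  have hN0 : 0 ≤ N := by positivity
  have key : ∀ (A : Matrix (Fin m) (Fin d) ℝ) (w : Fin m → ℝ),
      (∑ i, ∑ j, (A i j) ^ 2) + ∑ i, (w i) ^ 2 = 1 →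
      |deriv l (v ⬝ᵥ p) * (2 * (w ⬝ᵥ A.mulVec x))| ≤ 1 := by
    intro A w h
    rw [abs_mul]
    have := aux_cross w (A.mulVec x)
    have h3 := aux_mulVec A x hx
    have h4 : |2 * (w ⬝ᵥ A.mulVec x)| ≤ 1 := by linarith
    exact mul_le_one₀ hl1 (abs_nonneg _) h4
  have hup : ∀ c ∈ S, c ≤ D * N + 1 := by
    rintro c ⟨A, w, h, rfl⟩
    have hk := abs_le.mp (key A w h)
    have h3 := aux_mulVec A x hx
    have h5 : (w ⬝ᵥ p + v ⬝ᵥ A.mulVec x) ^ 2 ≤ N := by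
      refine (aux_cs w p v (A.mulVec x)).trans ?_
      exact mul_le_of_le_one_left hN0 (by linarith)
    have h6 := mul_le_mul_of_nonneg_left h5 hl2
    have e := aux_expand l h1 h2 x U A v w
    rw [← hp, ← hD] at e
    beta_reduce
    rw [e]
    linarith [hk.2]
  have hlow : ∀ c ∈ S, -1 ≤ c := by
    rintro c ⟨A, w, h, rfl⟩
    have hk := abs_le.mp (key A w h)
    have e := aux_expand l h1 h2 x U A v w
    rw [← hp, ← hD] at e
    beta_reduce
    rw [e]
    have := mul_nonneg hl2 (sq_nonneg (w ⬝ᵥ p + v ⬝ᵥ A.mulVec x))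
    linarith [hk.1]
  have hbdd : BddAbove S := ⟨_, hup⟩
  have hU : sSup S ≤ D * N + 1 := Real.sSup_le hup (by positivity)
  have hLo : D * N - 1 ≤ sSup S := by
    rcases hN0.eq_or_lt with h0 | hpos
    · rw [← h0, mul_zero]
      rcases S.eq_empty_or_nonempty with hE | ⟨c, hcS⟩
      · rw [hE, Real.sSup_empty]; norm_num
      · have := hlow c hcS
        have := le_csSup hbdd hcS
        linarith
    · set t := (Real.sqrt N)⁻¹ with ht
      have ht2 : t ^ 2 * N = 1 := by
        rw [ht, inv_pow, Real.sq_sqrt hN0]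
        exact inv_mul_cancel₀ hpos.ne'
      set A : Matrix (Fin m) (Fin d) ℝ := fun i j => t * v i * x j with hA
      set w : Fin m → ℝ := fun i => t * p i with hw
      have hAx : A.mulVec x = fun i => t * v i := by
        funext i
        have : A.mulVec x i = ∑ j, (t * v i) * x j ^ 2 := by
          simp only [Matrix.mulVec, dotProduct, hA]
          exact Finset.sum_congr rfl fun j _ => by ring
        rw [this, ← Finset.mul_sum, hx, mul_one]
      have hn : (∑ i, ∑ j, (A i j) ^ 2) + ∑ i, (w i) ^ 2 = 1 := by
        simp only [hA, hw, mul_pow, ← Finset.mul_sum, hx, mul_one]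
        rw [← ht2, hN]
        ring
      have hb : w ⬝ᵥ p + v ⬝ᵥ A.mulVec x = t * N := by
        rw [hAx, hN, mul_add, Finset.mul_sum, Finset.mul_sum]
        simp only [hw, dotProduct]
        congr 1 <;> exact Finset.sum_congr rfl fun j _ => by ring
      have hk := abs_le.mp (key A w hn)
      have e := aux_expand l h1 h2 x U A v w
      rw [← hp, ← hD, hb] at e
      have hb2 : (t * N) ^ 2 = N := by
        calc (t * N) ^ 2 = (t ^ 2 * N) * N := by ring
          _ = N := by rw [ht2, one_mul]
      rw [hb2] at e
      have hmem : D * N + deriv l (v ⬝ᵥ p) * (2 * (w ⬝ᵥ A.mulVec x)) ∈ S :=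
        ⟨A, w, hn, e⟩
      have := le_csSup hbdd hmem
      linarith [hk.1]
  rw [abs_le]
  constructor <;> linarith
end
end

section
/- Let η ∈ (0, r(1)/(2(r(1)+2))), and suppose the initialization (p₀, q₀) of the nonlinear reparameterized GD dynamics satisfies |p₀| ≤ 1 and q₀ ∈ (1/(1−2η), r(1)/(4η)). Then p_t converges to 0, the sequence (q_t) converges to a limit q*, and q₀ ≤ q* ≤ exp(2η·[min{2(q₀−1)/q₀, r(1)/q₀}]^{-1})·q₀ ≤ 2q₀. -/
open Filter
open scoped Classical

noncomputable section

/-- Assumption (Φ): sigmoidal activation. -/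
def AssumptionPhi (φ : ℝ → ℝ) : Prop :=
  (∀ x, φ (-x) = -φ x) ∧ StrictMono φ ∧ LipschitzWith 1 φ ∧ ContDiff ℝ 2 φ ∧
  φ 0 = 0 ∧ deriv φ 0 = 1 ∧ Tendsto φ atTop (nhds 1) ∧ Tendsto φ atBot (nhds (-1))

/-- The nonlinear reparameterized GD dynamics. -/
def NonlinDyn (φ r : ℝ → ℝ) (η : ℝ) (p q : ℕ → ℝ) : Prop :=
  (∀ t, p (t + 1) = (1 - 2 * r (p t) / q t) * p t) ∧
  (∀ t, q (t + 1) = ((1 - η * (φ (p t)) ^ 2) ^ 2)⁻¹ * q t)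

/-- `z₁ = sup {z : z r'(z)/r(z) ≥ -1}`. -/
def zOne (r : ℝ → ℝ) : ℝ := sSup {z : ℝ | z * deriv r z / r z ≥ -1}

/-- `c₀ = max {r(z₀), r(z₁) + 1/2}` for the nonlinear EoS setting. -/
def cZeroN (r : ℝ → ℝ) : ℝ := max (r (zZero r)) (r (zOne r) + 1 / 2)

/-- The function `h` of the nonlinear EoS Phase I theorem. -/
def hFunN (φ r : ℝ → ℝ) (p : ℝ) : ℝ :=
  if p = 0 then -(1 / deriv (deriv r) 0)
  else -((φ p) ^ 2 * r p / (p * deriv r p))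

set_option maxHeartbeats 2000000 in
/-- Gradient flow regime for the single-neuron nonlinear network. -/
theorem gradient_flow_regime_nonlinear (φ r : ℝ → ℝ) (η : ℝ) (p q : ℕ → ℝ)
    (hPhi : AssumptionPhi φ)
    (hr0 : r 0 = 1) (hrdef : ∀ z : ℝ, z ≠ 0 → r z = φ z * deriv φ z / z)
    (hR : AssumptionR r)
    (hdyn : NonlinDyn φ r η p q)
    (hη : η ∈ Set.Ioo (0 : ℝ) (r 1 / (2 * (r 1 + 2))))
    (hp0 : |p 0| ≤ 1)
    (hq0 : q 0 ∈ Set.Ioo (1 / (1 - 2 * η)) (r 1 / (4 * η))) :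
    Tendsto p atTop (nhds 0) ∧
    ∃ qstar : ℝ, Tendsto q atTop (nhds qstar) ∧
      q 0 ≤ qstar ∧
      qstar ≤ Real.exp (2 * η * (min (2 * (q 0 - 1) / q 0) (r 1 / q 0))⁻¹) * q 0 ∧
      Real.exp (2 * η * (min (2 * (q 0 - 1) / q 0) (r 1 / q 0))⁻¹) * q 0 ≤ 2 * q 0 := by
  obtain ⟨-, -, hLip, -, hφ0, -⟩ := hPhi
  obtain ⟨hev, hrC, -, -, hrd, hrt, -⟩ := hR
  obtain ⟨hp, hq⟩ := hdyn
  obtain ⟨hη0, hη1⟩ := hη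
  obtain ⟨hqa, hqb⟩ := hq0
  have hanti : StrictAntiOn r (Set.Ici 0) := by
    apply strictAntiOn_of_deriv_neg (convex_Ici 0) hrC.continuous.continuousOn
    intro x hx
    rw [interior_Ici] at hx
    exact hrd x hx
  have hr1n : 0 ≤ r 1 := by
    apply le_of_tendsto hrt
    filter_upwards [eventually_ge_atTop 1] with x hx
    exact hanti.antitoneOn (by simp) (by simp; linarith) hx
  have hr1 : 0 < r 1 := by
    rcases hr1n.lt_or_eq with h | h
    · exact h
    · rw [← h] at hη1
      simp at hη1
      linarith
  have hr11 : r 1 ≤ 1 := by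
    have h := hanti.antitoneOn (a := 0) (b := 1) (by simp) (by simp) (by norm_num)
    rwa [hr0] at h
  have hrb : ∀ x, |x| ≤ 1 → r 1 ≤ r x ∧ r x ≤ 1 := by
    intro x hx
    have h1 : r x = r |x| := by
      rcases abs_choice x with h | h <;> rw [h]
      exact (hev x).symm
    rw [h1]
    refine ⟨hanti.antitoneOn (abs_nonneg x) (by simp) hx, ?_⟩
    rw [← hr0]
    exact hanti.antitoneOn (by simp) (abs_nonneg x) (abs_nonneg x)
  have hφ : ∀ x, φ x ^ 2 ≤ x ^ 2 := by
    intro x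
    have h := hLip.dist_le_mul x 0
    simp [Real.dist_eq, hφ0] at h
    exact sq_le_sq.mpr h
  have hη6 : η ≤ 1 / 6 := by
    rw [lt_div_iff₀ (by linarith)] at hη1
    nlinarith
  have hq1 : 1 < q 0 * (1 - 2 * η) := by
    rwa [div_lt_iff₀ (by linarith)] at hqa
  have hqpos : 0 < q 0 := by
    by_contra h
    push Not at h
    nlinarith
  have hq4 : q 0 * (4 * η) < r 1 := by
    rwa [lt_div_iff₀ (by linarith)] at hqb
  set c := min (2 * (q 0 - 1) / q 0) (r 1 / q 0) with hc
  have hc1 : c * q 0 ≤ 2 * (q 0 - 1) := by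
    rw [← le_div_iff₀ hqpos]; exact min_le_left _ _
  have hc2 : c * q 0 ≤ r 1 := by
    rw [← le_div_iff₀ hqpos]; exact min_le_right _ _
  have hc4 : 4 * η < c := by
    apply lt_min
    · rw [lt_div_iff₀ hqpos]; nlinarith
    · rw [lt_div_iff₀ hqpos]; nlinarith
  have hc0 : 0 < c := by linarith
  have hc3 : c ≤ 2 / 3 := by
    by_contra h
    push Not at h
    nlinarith
  set K := 2 * η * c⁻¹ with hK
  have hK0 : 0 < K := by positivity
  have hKc : K * c = 2 * η := by rw [hK]; field_simp
  have hKh : K ≤ 1 / 2 := by nlinarith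
  have hexp : Real.exp K ≤ 2 := by
    have h1 : Real.exp K ^ 2 ≤ Real.exp 1 := by
      rw [← Real.exp_nat_mul]
      apply Real.exp_le_exp.mpr
      push_cast
      linarith
    have h2 := Real.exp_one_lt_d9
    have h3 := Real.exp_pos K
    nlinarith
  have inv : ∀ t, |p t| ≤ (1 - c) ^ t ∧ q 0 ≤ q t ∧
      q t ≤ Real.exp (K * (1 - ((1 - c) ^ t) ^ 2)) * q 0 ∧ q t ≤ q (t + 1) := by
    intro t
    have hmono : ∀ t, |p t| ≤ (1 - c) ^ t → 0 < q t → q t ≤ q (t + 1) ∧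
        q (t + 1) ≤ Real.exp (12 / 5 * η * ((1 - c) ^ t) ^ 2) * q t := by
      intro t h1 h2
      have ha0 : 0 ≤ (1 - c) ^ t := pow_nonneg (by linarith) t
      have ha1 : (1 - c) ^ t ≤ 1 := pow_le_one₀ (by linarith) (by linarith)
      have hx : φ (p t) ^ 2 ≤ ((1 - c) ^ t) ^ 2 :=
        (hφ _).trans (sq_le_sq.mpr (by rwa [abs_of_nonneg ha0]))
      have ha2 : ((1 - c) ^ t) ^ 2 ≤ 1 := pow_le_one₀ ha0 ha1
      set A := ((1 - c) ^ t) ^ 2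
      have hx0 : 0 ≤ η * φ (p t) ^ 2 := by positivity
      have hxA : η * φ (p t) ^ 2 ≤ η * A := by gcongr
      have hA6 : η * A ≤ 1 / 6 := by nlinarith
      rw [hq]
      set x := η * φ (p t) ^ 2
      have hpos : 0 < 1 - x := by linarith
      constructor
      · apply le_mul_of_one_le_left h2.le
        apply (one_le_inv₀ (by positivity)).mpr
        exact pow_le_one₀ hpos.le (by linarith)
      · apply mul_le_mul_of_nonneg_right _ h2.le
        have h3 : (1 - x)⁻¹ ≤ Real.exp (6 / 5 * x) := by
          have h4 := Real.add_one_le_exp (6 / 5 * x)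
          refine le_trans ?_ h4
          rw [inv_le_iff_one_le_mul₀ hpos]
          nlinarith
        calc ((1 - x) ^ 2)⁻¹ = ((1 - x)⁻¹) ^ 2 := by rw [inv_pow]
          _ ≤ Real.exp (6 / 5 * x) ^ 2 := by
            apply pow_le_pow_left₀ (by positivity) h3
          _ = Real.exp (2 * (6 / 5 * x)) := by rw [← Real.exp_nat_mul]; norm_num
          _ ≤ _ := by
            apply Real.exp_le_exp.mpr
            linarith
    have main : |p t| ≤ (1 - c) ^ t ∧ q 0 ≤ q t ∧
        q t ≤ Real.exp (K * (1 - ((1 - c) ^ t) ^ 2)) * q 0 := by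
      induction t with
      | zero => simp [hp0]
      | succ t ih =>
        obtain ⟨i1, i2, i3⟩ := ih
        have hqt : 0 < q t := by linarith
        obtain ⟨m1, m2⟩ := hmono t i1 hqt
        have ha1 : (1 - c) ^ t ≤ 1 := pow_le_one₀ (by linarith) (by linarith)
        have hq2 : q t ≤ 2 * q 0 := by
          refine i3.trans ?_
          apply mul_le_mul_of_nonneg_right _ hqpos.le
          refine le_trans ?_ hexp
          apply Real.exp_le_exp.mpr
          nlinarith [sq_nonneg ((1 - c) ^ t)]
        obtain ⟨b1, b2⟩ := hrb (p t) (i1.trans ha1)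
        refine ⟨?_, by linarith, ?_⟩
        · rw [hp, abs_mul, pow_succ, mul_comm]
          apply mul_le_mul i1 _ (abs_nonneg _) (pow_nonneg (by linarith) t)
          rw [abs_le]
          have e1 : 2 * r (p t) / q t ≤ 2 - c := by
            rw [div_le_iff₀ hqt]; nlinarith
          have e2 : c ≤ 2 * r (p t) / q t := by
            rw [le_div_iff₀ hqt]; nlinarith
          constructor <;> linarith
        · refine m2.trans ?_
          calc _ ≤ Real.exp (12 / 5 * η * ((1 - c) ^ t) ^ 2) *
                (Real.exp (K * (1 - ((1 - c) ^ t) ^ 2)) * q 0) := by gcongr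
            _ = Real.exp (12 / 5 * η * ((1 - c) ^ t) ^ 2 + K * (1 - ((1 - c) ^ t) ^ 2)) * q 0 := by
              rw [Real.exp_add]; ring
            _ ≤ _ := by
              apply mul_le_mul_of_nonneg_right _ hqpos.le
              apply Real.exp_le_exp.mpr
              rw [pow_succ (1 - c) t]
              have hA := sq_nonneg ((1 - c) ^ t)
              generalize (1 - c) ^ t = a at hA
              have e : K * (1 - (a * (1 - c)) ^ 2) =
                  K * (1 - a ^ 2) + a ^ 2 * ((K * c) * (2 - c)) := by ring
              rw [e, hKc]
              have : 12 / 5 * η ≤ 2 * η * (2 - c) := by nlinarith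
              nlinarith
    exact ⟨main.1, main.2.1, main.2.2, (hmono t main.1 (by linarith)).1⟩
  have hbd : ∀ t, q t ≤ Real.exp K * q 0 := by
    intro t
    refine (inv t).2.2.1.trans ?_
    apply mul_le_mul_of_nonneg_right _ hqpos.le
    apply Real.exp_le_exp.mpr
    nlinarith [sq_nonneg ((1 - c) ^ t)]
  refine ⟨?_, ⨆ t, q t, ?_, ?_, ciSup_le hbd, by gcongr⟩
  · apply squeeze_zero_norm (fun t => (inv t).1)
    exact tendsto_pow_atTop_nhds_zero_of_lt_one (by linarith) (by linarith)
  · apply tendsto_atTop_ciSup (monotone_nat_of_le_succ fun t => (inv t).2.2.2)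
    exact ⟨_, by rintro _ ⟨t, rfl⟩; exact hbd t⟩
  · exact le_ciSup (f := q) ⟨_, by rintro _ ⟨t, rfl⟩; exact hbd t⟩ 0
end
end

section
/- There exist constants η₀ > 0, c > 0, C > 0 depending only on δ and φ such that for every step size η ∈ (0, η₀) the following holds. Suppose |p₀| ≤ 1, q₀ ∈ (c₀, 1−δ), and p_t ≠ 0 for every t with q_t < 1. Then there exists a time step t_b ≥ c(1−q₀)η^{-1} such that q_{t_b} ≤ 1 and q_t > 1 for all t > t_b. Moreover p_t converges to 0, q_t converges to a limit q*, and |q* − 1 + η/r''(0)| ≤ Cη². -/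
open Filter
open scoped Classical

noncomputable section

/-- Analytic facts about `r`, its derivative `rd`, and `w = φ²` used by the dynamics. -/
structure EosFacts (r rd w : ℝ → ℝ) (c0 a M κ L ε0 ρ0 : ℝ) : Prop where
  c0_half : 1 / 2 < c0
  a_pos : 0 < a
  M_one : 1 ≤ M
  κ_pos : 0 < κ
  L_pos : 0 < L
  ε0_pos : 0 < ε0
  ρ0_pos : 0 < ρ0
  f1 : ∀ x, 0 ≤ x → x ≤ M → κ * x ^ 2 ≤ -(x * rd x)
  f2 : ∀ x, 0 ≤ x → x ≤ M → |-(x * rd x) - a * x ^ 2| ≤ L * x ^ 4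
  f3 : ∀ x, 0 ≤ x → x ≤ M → |r x - 1| ≤ L * x ^ 2
  f4 : ∀ x y, 0 ≤ x → x ≤ M → 0 ≤ y → y ≤ 2 * M →
    |r y - r x - rd x * (y - x)| ≤ L * (y - x) ^ 2
  f5 : ∀ x, 0 ≤ x → x ≤ M → |w x - x ^ 2| ≤ L * x ^ 4
  w_nn : ∀ x, 0 ≤ w x
  w_one : ∀ x, w x ≤ 1
  w_sq : ∀ x, w x ≤ x ^ 2
  f6 : ∀ x, 0 ≤ x → c0 - ε0 ≤ r x → x ≤ M ∧ -(x * rd x) ≤ 3 / 4 * r x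
  f7 : ∀ x q, 0 ≤ x → c0 < q → q ≤ 1 → q ≤ r x → q ≤ r (x * (2 * r x / q - 1))
  f8 : ∀ x, 0 ≤ x → x ≤ M → ρ0 ≤ r x

theorem eos_descent (P S : ℕ → Prop) (W : ℕ → ℝ) (d : ℝ) (hd : 0 < d) (T : ℕ) (h0 : P T)
    (hW : ∀ t, P t → 0 ≤ W t)
    (hs : ∀ t, P t → ¬ S t → P (t + 1) ∧ W (t + 1) ≤ W t - d) : ∃ t, T ≤ t ∧ P t ∧ S t := by
  by_contra hcon
  push Not at hcon
  have key : ∀ n : ℕ, P (T + n) ∧ W (T + n) ≤ W T - n * d := by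
    intro n
    induction n with
    | zero => simpa using h0
    | succ k ih =>
      obtain ⟨h1, h2⟩ := hs (T + k) ih.1 (hcon _ (by omega) ih.1)
      refine ⟨h1, ?_⟩
      push_cast
      rw [← add_assoc]
      linarith [ih.2]
  obtain ⟨n, hn⟩ := exists_nat_gt (W T / d)
  rw [div_lt_iff₀ hd] at hn
  have := hW _ (key n).1
  linarith [(key n).2]

theorem eos_qstep (q s : ℝ) (hs : 0 ≤ s) (hs4 : s ≤ 1 / 4) (hq : 0 < q) (hq2 : q ≤ 2) :
    q ≤ ((1 - s) ^ 2)⁻¹ * q ∧ |((1 - s) ^ 2)⁻¹ * q - q - 2 * s * q| ≤ 16 * s ^ 2 ∧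
      ((1 - s) ^ 2)⁻¹ * q ≤ q + 8 * s := by
  have hp : 0 < (1 - s) ^ 2 := by nlinarith
  have e : ((1 - s) ^ 2)⁻¹ * q - q - 2 * s * q = q * (3 * s ^ 2 - 2 * s ^ 3) / (1 - s) ^ 2 := by
    have hs1 : 1 - s ≠ 0 := by linarith
    field_simp; ring
  have h1 : 0 ≤ q * (3 * s ^ 2 - 2 * s ^ 3) / (1 - s) ^ 2 := by
    apply div_nonneg _ hp.le
    apply mul_nonneg hq.le
    nlinarith [sq_nonneg s]
  have h2 : q * (3 * s ^ 2 - 2 * s ^ 3) / (1 - s) ^ 2 ≤ 16 * s ^ 2 := by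
    rw [div_le_iff₀ hp]
    have ha : 9 / 16 ≤ (1 - s) ^ 2 := by nlinarith
    have hb : q * (3 * s ^ 2 - 2 * s ^ 3) ≤ 6 * s ^ 2 := by
      have : 0 ≤ s ^ 3 := by positivity
      have h3 : 3 * s ^ 2 - 2 * s ^ 3 ≤ 3 * s ^ 2 := by linarith
      have h4 : 0 ≤ s ^ 2 := sq_nonneg s
      nlinarith
    nlinarith [sq_nonneg s]
  have h5 : 2 * s * q ≤ 4 * s := by nlinarith
  have h6 : 16 * s ^ 2 ≤ 4 * s := by nlinarith
  have h7 : 0 ≤ 2 * s * q := by positivity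
  refine ⟨by linarith, ?_, by linarith⟩
  rw [e, abs_of_nonneg h1]; exact h2

/-- One step of the dynamics when `u = q - r x` is small. -/
theorem eos_ustep {r rd w : ℝ → ℝ} {c0 a M κ L ε0 ρ0 : ℝ} (F : EosFacts r rd w c0 a M κ L ε0 ρ0)
    (c ε η x q x' q' : ℝ) (hc : 0 < c) (hcκ : 2 * c ≤ κ) (hcM : 8 * c * M ^ 2 ≤ 1)
    (hε : 0 < ε) (hε12 : ε ≤ 1 / 12) (hε0 : ε ≤ ε0) (hεL : 16 * L * ε ≤ c)
    (hη : 0 < η) (hη4 : η ≤ 1 / 4)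
    (hx : 0 ≤ x) (hq : c0 < q) (hq2 : q ≤ 2) (hu : |q - r x| ≤ ε)
    (hx' : x' = |1 - 2 * r x / q| * x) (hq' : q' = ((1 - η * w x) ^ 2)⁻¹ * q) :
    x ≤ M ∧ q ≤ q' ∧ q' ≤ q + 8 * η * x ^ 2 ∧ x' = x - 2 * x * (q - r x) / q ∧
    |q' - q - 2 * η * w x * q| ≤ 16 * η ^ 2 * x ^ 2 ∧
    |q' - r x' - ((q - r x) * (1 - (-(2 * (x * rd x)) / q)) + (q' - q))|
      ≤ 16 * L * x ^ 2 * (q - r x) ^ 2 ∧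
    |1 - (-(2 * (x * rd x)) / q)| ≤ 1 - 2 * c * x ^ 2 ∧
    |q' - r x'| ≤ (1 - c * x ^ 2) * |q - r x| + 8 * η * x ^ 2 := by
  have hc0 := F.c0_half
  have hM := F.M_one
  have hL := F.L_pos
  have hq0 : 0 < q := by linarith
  set u := q - r x with hudef
  have hru : r x = q - u := by rw [hudef]; ring
  have hu1 := abs_le.mp hu
  obtain ⟨hxM, hg⟩ := F.f6 x hx (by linarith)
  have hw0 := F.w_nn x
  have hw1 := F.w_one x
  have hw2 := F.w_sq x
  obtain ⟨hq1', hq2', hq3'⟩ := eos_qstep q (η * w x) (by positivity) (by linarith [mul_le_of_le_one_right hη.le hw1]) hq0 hq2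
  rw [← hq'] at hq1' hq2' hq3'
  have hx2 : 0 ≤ x ^ 2 := sq_nonneg x
  have hηw : η * w x ≤ η * x ^ 2 := by gcongr
  have A3 : q' ≤ q + 8 * η * x ^ 2 := by linarith
  have A4 : x' = x - 2 * x * u / q := by
    have : 1 - 2 * r x / q = -(1 - 2 * u / q) := by rw [hru]; field_simp; ring
    have h2 : 0 ≤ 1 - 2 * u / q := by
      have : 2 * u / q ≤ 1 := by rw [div_le_one hq0]; linarith
      linarith
    rw [hx', this, abs_neg, abs_of_nonneg h2]; ring
  have A5 : |q' - q - 2 * η * w x * q| ≤ 16 * η ^ 2 * x ^ 2 := by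
    have e : q' - q - 2 * η * w x * q = q' - q - 2 * (η * w x) * q := by ring
    rw [e]
    refine hq2'.trans ?_
    have : w x ^ 2 ≤ x ^ 2 := by linarith [mul_le_of_le_one_right hw0 hw1, sq (w x)]
    have hh : 0 ≤ η ^ 2 := sq_nonneg η
    linarith [mul_le_mul_of_nonneg_left this hh]
  have hx0' : 0 ≤ x' := by rw [hx']; positivity
  have hd : x' - x = -(2 * x * u / q) := by rw [A4]; ring
  have hd2 : (x' - x) ^ 2 ≤ 16 * x ^ 2 * u ^ 2 := by
    rw [hd]
    have : (-(2 * x * u / q)) ^ 2 = 4 * (x ^ 2 * u ^ 2) / q ^ 2 := by field_simp; ring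
    rw [this, div_le_iff₀ (by positivity)]
    have h1 : 1 / 4 ≤ q ^ 2 := by linarith [sq_nonneg (q - 1 / 2)]
    have h2 : 0 ≤ x ^ 2 * u ^ 2 := by positivity
    linarith [mul_le_mul_of_nonneg_left h1 h2]
  have hx2M : x' ≤ 2 * M := by
    have h1 : -(2 * x * u / q) ≤ x := by
      rw [← neg_div, div_le_iff₀ hq0]; linarith [mul_nonneg hx (by linarith : 0 ≤ q + 2 * u)]
    linarith
  have h4 := F.f4 x x' hx hxM hx0' hx2M
  have A6 : |q' - r x' - (u * (1 - (-(2 * (x * rd x)) / q)) + (q' - q))|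
      ≤ 16 * L * x ^ 2 * u ^ 2 := by
    have e : q' - r x' - (u * (1 - (-(2 * (x * rd x)) / q)) + (q' - q))
        = -(r x' - r x - rd x * (x' - x)) := by
      rw [hd, hru]; field_simp; ring
    rw [e, abs_neg]
    refine h4.trans ?_
    calc L * (x' - x) ^ 2 ≤ L * (16 * x ^ 2 * u ^ 2) := mul_le_mul_of_nonneg_left hd2 hL.le
      _ = _ := by ring
  have A7 : |1 - (-(2 * (x * rd x)) / q)| ≤ 1 - 2 * c * x ^ 2 := by
    have h1 := F.f1 x hx hxM
    have hxM2 : x ^ 2 ≤ M ^ 2 := by gcongr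
    have t1 : 2 * c * x ^ 2 ≤ -(2 * (x * rd x)) / q := by
      rw [le_div_iff₀ hq0]
      have : 2 * c * x ^ 2 ≤ κ * x ^ 2 := by gcongr
      have h0 : 0 ≤ 2 * c * x ^ 2 := by positivity
      linarith [mul_le_mul_of_nonneg_left hq2 h0]
    have t2 : -(2 * (x * rd x)) / q ≤ 7 / 4 := by
      rw [div_le_iff₀ hq0]
      linarith [hru]
    have t3 : 2 * c * x ^ 2 ≤ 1 / 4 := by linarith [mul_le_mul_of_nonneg_left hxM2 hc.le]
    rw [abs_le]; constructor <;> linarith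
  refine ⟨hxM, hq1', A3, A4, A5, A6, A7, ?_⟩
  have h0 : |q' - r x'| ≤ |u * (1 - (-(2 * (x * rd x)) / q)) + (q' - q)|
      + 16 * L * x ^ 2 * u ^ 2 := by
    have := abs_sub_abs_le_abs_sub (q' - r x') (u * (1 - (-(2 * (x * rd x)) / q)) + (q' - q))
    linarith
  have h1 : |u * (1 - (-(2 * (x * rd x)) / q)) + (q' - q)|
      ≤ |u| * (1 - 2 * c * x ^ 2) + 8 * η * x ^ 2 := by
    refine (abs_add_le _ _).trans ?_
    rw [abs_mul, abs_of_nonneg (by linarith : 0 ≤ q' - q)]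
    have := mul_le_mul_of_nonneg_left A7 (abs_nonneg u)
    linarith
  have h2 : 16 * L * x ^ 2 * u ^ 2 ≤ c * x ^ 2 * |u| := by
    rw [← sq_abs u]
    have h3 : 16 * L * |u| ≤ c := by linarith [mul_le_mul_of_nonneg_left hu (by positivity : 0 ≤ 16 * L)]
    have h4 : 0 ≤ x ^ 2 * |u| := by positivity
    linarith [mul_le_mul_of_nonneg_right h3 h4]
  linarith

theorem eos_qstep' {r rd w : ℝ → ℝ} {c0 a M κ L ε0 ρ0 : ℝ} (F : EosFacts r rd w c0 a M κ L ε0 ρ0)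
    (η x q : ℝ) (hη : 0 < η) (hη4 : η ≤ 1 / 4) (hq : c0 < q) (hq2 : q ≤ 2) :
    q ≤ ((1 - η * w x) ^ 2)⁻¹ * q ∧ ((1 - η * w x) ^ 2)⁻¹ * q ≤ q + 8 * η * x ^ 2 ∧
      ((1 - η * w x) ^ 2)⁻¹ * q ≤ q + 8 * η := by
  have hc0 := F.c0_half
  have hw0 := F.w_nn x
  have hw1 := F.w_one x
  have hw2 := F.w_sq x
  obtain ⟨h1, _, h3⟩ := eos_qstep q (η * w x) (by positivity)
    (by linarith [mul_le_of_le_one_right hη.le hw1]) (by linarith) hq2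
  refine ⟨h1, ?_, ?_⟩
  · linarith [mul_le_mul_of_nonneg_left hw2 hη.le]
  · linarith [mul_le_mul_of_nonneg_left hw1 hη.le]

theorem eos_phase0a {r rd w : ℝ → ℝ} {c0 a M κ L ε0 ρ0 : ℝ} (F : EosFacts r rd w c0 a M κ L ε0 ρ0)
    (δ ε η D c1 xm : ℝ) (hδ : 0 < δ) (hδ1 : δ < 1) (hε : 0 < ε) (hεδ : ε ≤ δ / 12)
    (hη : 0 < η) (hη4 : η ≤ 1 / 4) (hc1 : 0 < c1) (hc1ρ : c1 ≤ 2 * ρ0) (hc1ε : c1 ≤ 2 * ε)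
    (hD : 0 < D) (hDc : D * c1 = 8 * M) (hDη : D * η * M ≤ δ / 12)
    (hxm0 : 0 < xm) (hxm : ∀ y, 0 ≤ y → y ≤ M → r y ≤ 1 - δ / 3 → xm ≤ y)
    (x q : ℕ → ℝ) (hx : ∀ t, 0 ≤ x t)
    (hdx : ∀ t, x (t + 1) = |1 - 2 * r (x t) / q t| * x t)
    (hdq : ∀ t, q (t + 1) = ((1 - η * w (x t)) ^ 2)⁻¹ * q t)
    (hx0 : x 0 ≤ 1) (hq0 : c0 < q 0) (hq0' : q 0 < 1 - δ) :
    ∃ t, x t ≤ M ∧ c0 < q t ∧ q t + D * η * x t ≤ q 0 + D * η * x 0 ∧ q t - r (x t) ≤ ε := by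
  have hM := F.M_one
  have hc0 := F.c0_half
  have hDη0 : 0 < D * η := by positivity
  obtain ⟨t, -, ht⟩ := eos_descent
    (fun t => x t ≤ M ∧ c0 < q t ∧ q t + D * η * x t ≤ q 0 + D * η * x 0)
    (fun t => q t - r (x t) ≤ ε) x (c1 * xm) (by positivity) 0 ⟨by linarith, hq0, le_rfl⟩
    (fun t _ => hx t) (by
      rintro t ⟨h1, h2, h3⟩ h4
      push Not at h4
      have hxt := hx t
      have e1 : D * η * x 0 ≤ D * η * M := mul_le_mul_of_nonneg_left (by linarith) hDη0.le
      have e2 : 0 ≤ D * η * x t := by positivity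
      have hqt : q t ≤ 1 - δ + δ / 12 := by linarith
      have hqp : 0 < q t := by linarith
      have hr := F.f8 _ hxt h1
      have hxmt := hxm _ hxt h1 (by linarith)
      have hb : |1 - 2 * r (x t) / q t| ≤ 1 - c1 := by
        rw [abs_le]
        constructor
        · have : 2 * r (x t) / q t ≤ 2 - c1 := by
            rw [div_le_iff₀ hqp]
            linarith [mul_le_mul_of_nonneg_left (by linarith : q t ≤ 1) hc1.le]
          linarith
        · have : c1 ≤ 2 * r (x t) / q t := by
            rw [le_div_iff₀ hqp]
            linarith [mul_le_mul_of_nonneg_left (by linarith : q t ≤ 1) hc1.le]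
          linarith
      have hx' : x (t + 1) ≤ x t - c1 * x t := by
        rw [hdx]
        linarith [mul_le_mul_of_nonneg_right hb hxt]
      obtain ⟨g1, g2, g3⟩ := eos_qstep' F η (x t) (q t) hη hη4 h2 (by linarith)
      rw [← hdq] at g1 g2 g3
      have hcx : c1 * xm ≤ c1 * x t := mul_le_mul_of_nonneg_left hxmt hc1.le
      have hcx0 : 0 < c1 * xm := by positivity
      refine ⟨⟨by linarith, by linarith, ?_⟩, by linarith⟩
      have k1 : D * η * x (t + 1) ≤ D * η * (x t - c1 * x t) :=
        mul_le_mul_of_nonneg_left hx' hDη0.le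
      have k2 : D * η * (x t - c1 * x t) = D * η * x t - 8 * M * (η * x t) := by
        rw [← hDc]; ring
      have k3 : 8 * η * x t ^ 2 ≤ 8 * M * (η * x t) := by
        have : 0 ≤ η * x t := by positivity
        linarith [mul_le_mul_of_nonneg_left h1 this]
      linarith)
  exact ⟨t, ht.1.1, ht.1.2.1, ht.1.2.2, ht.2⟩

theorem eos_phase0b {r rd w : ℝ → ℝ} {c0 a M κ L ε0 ρ0 : ℝ} (F : EosFacts r rd w c0 a M κ L ε0 ρ0)
    (δ ε η D c1 : ℝ) (hδ : 0 < δ) (hδ1 : δ < 1) (hε : 0 < ε) (hε0 : ε ≤ ε0)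
    (hη : 0 < η) (hη4 : η ≤ 1 / 4) (hηε : 8 * η ≤ ε) (hc1 : 0 < c1) (hc1ε : c1 ≤ 2 * ε)
    (hD : 0 < D) (hDc : D * c1 = 8 * M) (hDη : D * η * M ≤ δ / 12)
    (x q : ℕ → ℝ) (hx : ∀ t, 0 ≤ x t)
    (hdx : ∀ t, x (t + 1) = |1 - 2 * r (x t) / q t| * x t)
    (hdq : ∀ t, q (t + 1) = ((1 - η * w (x t)) ^ 2)⁻¹ * q t)
    (T : ℕ) (hxT0 : 0 < x T) (hxT : x T ≤ M) (hqT : c0 < q T) (hqT' : q T ≤ 1 - δ + δ / 12)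
    (huT : q T - r (x T) ≤ ε) :
    ∃ t, c0 < q t ∧ q t ≤ 1 - δ + δ / 6 ∧ |q t - r (x t)| ≤ ε := by
  have hM := F.M_one
  have hc0 := F.c0_half
  have hDη0 : 0 < D * η := by positivity
  have hbd : ∀ t, x t ≤ M → q t - D * η * x t ≤ q T - D * η * x T → q t ≤ 1 - δ + δ / 6 := by
    intro t h1 h2
    have e1 : D * η * x t ≤ D * η * M := mul_le_mul_of_nonneg_left h1 hDη0.le
    have e2 : 0 ≤ D * η * x T := by positivity
    linarith
  obtain ⟨t, -, ht⟩ := eos_descent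
    (fun t => x t ≤ M ∧ c0 < q t ∧ q t - D * η * x t ≤ q T - D * η * x T ∧
      q t - r (x t) ≤ ε ∧ x T ≤ x t)
    (fun t => -ε ≤ q t - r (x t)) (fun t => M - x t) (c1 * x T) (by positivity) T
    ⟨hxT, hqT, le_rfl, huT, le_rfl⟩ (fun t h => by linarith [h.1]) (by
      rintro t ⟨h1, h2, h3, h4, h5⟩ h6
      push Not at h6
      have hxt := hx t
      have hqt := hbd t h1 h3
      have hqp : 0 < q t := by linarith
      obtain ⟨g1, g2, g3⟩ := eos_qstep' F η (x t) (q t) hη hη4 h2 (by linarith)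
      rw [← hdq] at g1 g2 g3
      have hge : 1 + c1 ≤ 2 * r (x t) / q t - 1 := by
        have : 2 + c1 ≤ 2 * r (x t) / q t := by
          rw [le_div_iff₀ hqp]
          linarith [mul_le_mul_of_nonneg_left (by linarith : q t ≤ 1) hc1.le]
        linarith
      have hxe : x (t + 1) = x t * (2 * r (x t) / q t - 1) := by
        rw [hdx, ← abs_neg, abs_of_nonneg (by linarith)]; ring
      have hx' : x t + c1 * x t ≤ x (t + 1) := by
        rw [hxe]
        linarith [mul_le_mul_of_nonneg_left hge hxt]
      have hr' : q t ≤ r (x (t + 1)) := by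
        rw [hxe]; exact F.f7 _ _ hxt h2 (by linarith) (by linarith)
      have hM' := (F.f6 (x (t + 1)) (hx _) (by linarith [F.ε0_pos])).1
      have hcx : c1 * x T ≤ c1 * x t := mul_le_mul_of_nonneg_left h5 hc1.le
      have hcx0 : 0 < c1 * x T := by positivity
      refine ⟨⟨hM', by linarith, ?_, by linarith, by linarith⟩, by linarith⟩
      have k1 : D * η * (x t + c1 * x t) ≤ D * η * x (t + 1) :=
        mul_le_mul_of_nonneg_left hx' hDη0.le
      have k2 : D * η * (x t + c1 * x t) = D * η * x t + 8 * M * (η * x t) := by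
        rw [← hDc]; ring
      have k3 : 8 * η * x t ^ 2 ≤ 8 * M * (η * x t) := by
        have : 0 ≤ η * x t := by positivity
        linarith [mul_le_mul_of_nonneg_left h1 this]
      linarith)
  obtain ⟨⟨h1, h2, h3, h4, h5⟩, h6⟩ := ht
  exact ⟨t, h2, hbd t h1 h3, abs_le.mpr ⟨h6, h4⟩⟩

theorem eos_phase1 {r rd w : ℝ → ℝ} {c0 a M κ L ε0 ρ0 : ℝ} (F : EosFacts r rd w c0 a M κ L ε0 ρ0)
    (δ c ε η xm K : ℝ) (hδ : 0 < δ) (hδ1 : δ < 1)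
    (hc : 0 < c) (hcκ : 2 * c ≤ κ) (hcM : 8 * c * M ^ 2 ≤ 1)
    (hε : 0 < ε) (hε12 : ε ≤ 1 / 12) (hε0 : ε ≤ ε0) (hεL : 16 * L * ε ≤ c) (hεδ : ε ≤ δ / 12)
    (hη : 0 < η) (hη4 : η ≤ 1 / 4) (hKc : c * K = 16)
    (hxm0 : 0 < xm) (hxm : ∀ y, 0 ≤ y → y ≤ M → r y ≤ 1 - δ / 3 → xm ≤ y)
    (x q : ℕ → ℝ) (hx : ∀ t, 0 ≤ x t)
    (hdx : ∀ t, x (t + 1) = |1 - 2 * r (x t) / q t| * x t)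
    (hdq : ∀ t, q (t + 1) = ((1 - η * w (x t)) ^ 2)⁻¹ * q t)
    (T : ℕ) (hqT : c0 < q T) (hqT' : q T ≤ 1 - δ + δ / 6) (huT : |q T - r (x T)| ≤ ε) :
    ∃ t, c0 < q t ∧ |q t - r (x t)| ≤ K * η ∧ xm ≤ x t := by
  have hlow : ∀ t, c0 < q t → |q t - r (x t)| ≤ ε →
      q t + |q t - r (x t)| ≤ q T + |q T - r (x T)| → q t ≤ 1 ∧ xm ≤ x t := by
    intro t h1 h2 h3
    have h4 := abs_le.mp h2
    have h0 := abs_nonneg (q t - r (x t))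
    have := (F.f6 (x t) (hx t) (by linarith)).1
    exact ⟨by linarith, hxm _ (hx t) this (by linarith)⟩
  obtain ⟨t, -, ht⟩ := eos_descent
    (fun t => c0 < q t ∧ |q t - r (x t)| ≤ ε ∧
      q t + |q t - r (x t)| ≤ q T + |q T - r (x T)|)
    (fun t => |q t - r (x t)| ≤ K * η) (fun t => |q t - r (x t)|) (8 * η * xm ^ 2)
    (by positivity) T ⟨hqT, huT, le_rfl⟩ (fun t h => abs_nonneg _) (by
      rintro t ⟨h1, h2, h3⟩ h4
      push Not at h4
      obtain ⟨l1, l2⟩ := hlow t h1 h2 h3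
      obtain ⟨s1, s2, s3, -, -, -, -, s8⟩ := eos_ustep F c ε η (x t) (q t) (x (t + 1)) (q (t + 1))
        hc hcκ hcM hε hε12 hε0 hεL hη hη4 (hx t) h1 (by linarith) h2 (hdx t) (hdq t)
      have hx2 : xm ^ 2 ≤ x t ^ 2 := by gcongr
      have k1 : 16 * η * x t ^ 2 ≤ c * x t ^ 2 * |q t - r (x t)| := by
        have := mul_le_mul_of_nonneg_left h4.le (by positivity : 0 ≤ c * x t ^ 2)
        have e : c * x t ^ 2 * (K * η) = 16 * η * x t ^ 2 := by rw [← hKc]; ring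
        linarith
      have k2 : 8 * η * xm ^ 2 ≤ 8 * η * x t ^ 2 := by gcongr
      have k3 : 0 < 8 * η * xm ^ 2 := by positivity
      refine ⟨⟨by linarith, by linarith, by linarith⟩, by linarith⟩)
  obtain ⟨⟨h1, h2, h3⟩, h4⟩ := ht
  exact ⟨t, h1, h4, (hlow t h1 h2 h3).2⟩

theorem eos_phase2 {r rd w : ℝ → ℝ} {c0 a M κ L ε0 ρ0 : ℝ} (F : EosFacts r rd w c0 a M κ L ε0 ρ0)
    (c ε η K K2 K3 C2 : ℝ)
    (hc : 0 < c) (hcκ : 2 * c ≤ κ) (hcM : 8 * c * M ^ 2 ≤ 1)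
    (hε : 0 < ε) (hε12 : ε ≤ 1 / 12) (hε0 : ε ≤ ε0) (hεL : 16 * L * ε ≤ c)
    (hη : 0 < η) (hη4 : η ≤ 1 / 4) (hKc : c * K = 16) (hK : 0 < K) (hKη : K * η ≤ ε)
    (hC2 : C2 = 16 * L * K ^ 2 + 16 + 2 * (3 * L + K) + 4 / a * (L + a * (K + L)))
    (hK2 : C2 ≤ 2 * c * K2) (hK20 : 0 < K2) (hK3 : C2 + 8 * K * K2 ≤ 2 * c * K3)
    (x q x' q' : ℝ) (hx : 0 ≤ x)
    (hdx : x' = |1 - 2 * r x / q| * x)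
    (hdq : q' = ((1 - η * w x) ^ 2)⁻¹ * q)
    (hq : c0 < q) (hu : |q - r x| ≤ K * η)
    (hE : |q - r x - η / a| ≤ K2 * η * x ^ 2 + K3 * η ^ 2) (hr1 : r x ≤ 1) :
    c0 < q' ∧ |q' - r x'| ≤ K * η ∧ |q' - r x' - η / a| ≤ K2 * η * x' ^ 2 + K3 * η ^ 2 := by
  have ha := F.a_pos
  have hL := F.L_pos
  have hc0 := F.c0_half
  have hq2 : q ≤ 2 := by linarith [(abs_le.mp hu).2]
  have hq0 : 0 < q := by linarith
  obtain ⟨s1, s2, s3, s4, s5, s6, s7, s8⟩ := eos_ustep F c ε η x q x' q'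
        hc hcκ hcM hε hε12 hε0 hεL hη hη4 hx hq hq2 (hu.trans hKη) hdx hdq
  have hx2 : 0 ≤ x ^ 2 := sq_nonneg x
  have hx4 : 0 ≤ x ^ 4 := by positivity
  refine ⟨by linarith, ?_, ?_⟩
  · have hcx : 0 ≤ 1 - c * x ^ 2 := by
      have := abs_nonneg (1 - (-(2 * (x * rd x)) / q))
      have h3 : 0 ≤ c * x ^ 2 := by positivity
      linarith
    have k1 := mul_le_mul_of_nonneg_left hu hcx
    have e : (1 - c * x ^ 2) * (K * η) = K * η - 16 * η * x ^ 2 := by rw [← hKc]; ring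
    have : 0 ≤ 8 * η * x ^ 2 := by positivity
    linarith
  · have f2 := F.f2 x hx s1
    have f3 := F.f3 x hx s1
    have f5 := F.f5 x hx s1
    set u := q - r x with hudef
    set θ := -(2 * (x * rd x)) / q with hθ
    have hq1 : |q - 1| ≤ K * η + L * x ^ 2 := by
      have e : q - 1 = u + (r x - 1) := by rw [hudef]; ring
      rw [e]
      exact (abs_add_le _ _).trans (add_le_add hu f3)
    have T1 : |q' - r x' - (u * (1 - θ) + (q' - q))| ≤ 16 * L * K ^ 2 * (η ^ 2 * x ^ 2) := by
      refine s6.trans ?_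
      have : u ^ 2 ≤ (K * η) ^ 2 := by
        rw [← sq_abs u]; gcongr
      calc 16 * L * x ^ 2 * u ^ 2 ≤ 16 * L * x ^ 2 * (K * η) ^ 2 := by gcongr
        _ = _ := by ring
    have T3 : |w x * q - x ^ 2| ≤ 3 * L * x ^ 4 + K * (η * x ^ 2) := by
      have e : w x * q - x ^ 2 = (w x - x ^ 2) * q + x ^ 2 * (q - 1) := by ring
      rw [e]
      refine (abs_add_le _ _).trans ?_
      rw [abs_mul, abs_mul, abs_of_pos hq0, abs_of_nonneg hx2]
      have h1 : |w x - x ^ 2| * q ≤ L * x ^ 4 * 2 := by gcongr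
      have h2 : x ^ 2 * |q - 1| ≤ x ^ 2 * (K * η + L * x ^ 2) := by gcongr
      calc _ ≤ L * x ^ 4 * 2 + x ^ 2 * (K * η + L * x ^ 2) := add_le_add h1 h2
        _ = _ := by ring
    have T4 : |2 * x ^ 2 - θ / a| ≤
        4 / a * (L + a * L) * x ^ 4 + 4 / a * (a * K) * (η * x ^ 2) := by
      have e : 2 * x ^ 2 - θ / a
          = (2 / (a * q)) * (a * x ^ 2 * (q - 1) - (-(x * rd x) - a * x ^ 2)) := by
        rw [hθ]; field_simp; ring
      have h1 : |a * x ^ 2 * (q - 1) - (-(x * rd x) - a * x ^ 2)|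
          ≤ a * x ^ 2 * (K * η + L * x ^ 2) + L * x ^ 4 := by
        refine (abs_sub _ _).trans ?_
        refine add_le_add ?_ f2
        rw [abs_mul, abs_of_nonneg (by positivity : 0 ≤ a * x ^ 2)]
        gcongr
      have h2 : 2 / (a * q) ≤ 4 / a := by
        rw [div_le_div_iff₀ (by positivity) ha]
        linarith [mul_le_mul_of_nonneg_left (by linarith : 1 / 2 ≤ q) ha.le]
      rw [e, abs_mul, abs_of_nonneg (by positivity : 0 ≤ 2 / (a * q))]
      calc _ ≤ 4 / a * (a * x ^ 2 * (K * η + L * x ^ 2) + L * x ^ 4) := by gcongr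
        _ = _ := by ring
    have hx'2 : x ^ 2 - 8 * K * η * x ^ 2 ≤ x' ^ 2 := by
      have e : x' ^ 2 = x ^ 2 - x ^ 2 * (4 * u / q) + x ^ 2 * (2 * u / q) ^ 2 := by
        rw [s4]; ring
      have h1 : 4 * u / q ≤ 8 * K * η := by
        rw [div_le_iff₀ hq0]
        have h2 : u ≤ K * η := (le_abs_self u).trans hu
        have h3 : 0 ≤ K * η := by positivity
        linarith [mul_le_mul_of_nonneg_left (by linarith : 1 / 2 ≤ q) h3]
      have h2 : x ^ 2 * (4 * u / q) ≤ x ^ 2 * (8 * K * η) := by gcongr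
      have h3 : 0 ≤ x ^ 2 * (2 * u / q) ^ 2 := by positivity
      rw [e]; linarith
    have hB : K2 * η * x ^ 2 - 8 * K * K2 * (η ^ 2 * x ^ 2) ≤ K2 * η * x' ^ 2 := by
      calc K2 * η * x ^ 2 - 8 * K * K2 * (η ^ 2 * x ^ 2)
          = K2 * η * (x ^ 2 - 8 * K * η * x ^ 2) := by ring
        _ ≤ _ := by gcongr
    have T0 : |(u - η / a) * (1 - θ)| ≤
        (K2 * η * x ^ 2 + K3 * η ^ 2) * (1 - 2 * c * x ^ 2) := by
      rw [abs_mul]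
      exact mul_le_mul hE s7 (abs_nonneg _) ((abs_nonneg _).trans hE)
    have T3' : |2 * η * (w x * q - x ^ 2)| ≤ 2 * η * (3 * L * x ^ 4 + K * (η * x ^ 2)) := by
      rw [abs_mul, abs_of_nonneg (by positivity : 0 ≤ 2 * η)]; gcongr
    have T4' : |η * (2 * x ^ 2 - θ / a)| ≤
        η * (4 / a * (L + a * L) * x ^ 4 + 4 / a * (a * K) * (η * x ^ 2)) := by
      rw [abs_mul, abs_of_pos hη]; gcongr
    have tot : |q' - r x' - η / a| ≤ (K2 * η * x ^ 2 + K3 * η ^ 2) * (1 - 2 * c * x ^ 2)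
        + 16 * L * K ^ 2 * (η ^ 2 * x ^ 2) + 16 * η ^ 2 * x ^ 2
        + 2 * η * (3 * L * x ^ 4 + K * (η * x ^ 2))
        + η * (4 / a * (L + a * L) * x ^ 4 + 4 / a * (a * K) * (η * x ^ 2)) := by
      have e : q' - r x' - η / a = (u - η / a) * (1 - θ)
          + (q' - r x' - (u * (1 - θ) + (q' - q))) + (q' - q - 2 * η * w x * q)
          + 2 * η * (w x * q - x ^ 2) + η * (2 * x ^ 2 - θ / a) := by ring
      rw [e]
      refine (abs_add_le _ _).trans (add_le_add ?_ T4')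
      refine (abs_add_le _ _).trans (add_le_add ?_ T3')
      refine (abs_add_le _ _).trans (add_le_add ?_ s5)
      exact (abs_add_le _ _).trans (add_le_add T0 T1)
    refine tot.trans ?_
    have n1 : 0 ≤ η * x ^ 4 := by positivity
    have n2 : 0 ≤ η ^ 2 * x ^ 2 := by positivity
    have m1 := mul_le_mul_of_nonneg_right hK2 n1
    have m2 := mul_le_mul_of_nonneg_right hK3 n2
    have c1 : (2 * (3 * L) + 4 / a * (L + a * L)) * (η * x ^ 4) ≤ C2 * (η * x ^ 4) := by
      apply mul_le_mul_of_nonneg_right _ n1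
      have : 0 ≤ 16 * L * K ^ 2 + 16 + 2 * K + 4 / a * (a * K) := by positivity
      rw [hC2]; linarith
    have c2 : (16 * L * K ^ 2 + 16 + 2 * K + 4 / a * (a * K)) * (η ^ 2 * x ^ 2)
        ≤ C2 * (η ^ 2 * x ^ 2) := by
      apply mul_le_mul_of_nonneg_right _ n2
      have : 0 ≤ 2 * (3 * L) + 4 / a * (L + a * L) := by positivity
      rw [hC2]; linarith
    linarith

/-- The quantitative core: eventually the trajectory lies `O(η²)`-close to the slow manifold. -/
theorem eos_core {r rd w : ℝ → ℝ} {c0 a M κ L ε0 ρ0 : ℝ} (F : EosFacts r rd w c0 a M κ L ε0 ρ0)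
    (hr1 : ∀ y, r y ≤ 1) (δ : ℝ) (hδ : 0 < δ) (hδ1 : δ < 1) :
    ∃ η₀ > (0 : ℝ), ∃ K > (0 : ℝ), ∃ K2 > (0 : ℝ), ∃ K3 > (0 : ℝ), η₀ ≤ 1 / 4 ∧
      ∀ η : ℝ, 0 < η → η < η₀ → ∀ x q : ℕ → ℝ, (∀ t, 0 ≤ x t) →
      (∀ t, x (t + 1) = |1 - 2 * r (x t) / q t| * x t) →
      (∀ t, q (t + 1) = ((1 - η * w (x t)) ^ 2)⁻¹ * q t) →
      x 0 ≤ 1 → c0 < q 0 → q 0 < 1 - δ → (∀ t, q t < 1 → x t ≠ 0) →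
      ∃ T, ∀ t, T ≤ t → |q t - r (x t)| ≤ K * η ∧
        |q t - r (x t) - η / a| ≤ K2 * η * x t ^ 2 + K3 * η ^ 2 := by
  have hM := F.M_one
  have hM0 : 0 < M := by linarith
  have hL := F.L_pos
  have hκ := F.κ_pos
  have ha := F.a_pos
  have hρ := F.ρ0_pos
  have hε0 := F.ε0_pos
  obtain ⟨c, hc, hcκ, hcM⟩ : ∃ c > 0, 2 * c ≤ κ ∧ 8 * c * M ^ 2 ≤ 1 := by
    refine ⟨min (κ / 2) (1 / (8 * M ^ 2)), by positivity, ?_, ?_⟩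
    · linarith [min_le_left (κ / 2) (1 / (8 * M ^ 2))]
    · have := min_le_right (κ / 2) (1 / (8 * M ^ 2))
      rw [le_div_iff₀ (by positivity)] at this
      linarith
  obtain ⟨ε, hε, hε12, hεε0, hεL, hεδ⟩ : ∃ ε > 0, ε ≤ 1 / 12 ∧ ε ≤ ε0 ∧ 16 * L * ε ≤ c ∧
      ε ≤ δ / 12 := by
    refine ⟨min (min (1 / 12) ε0) (min (c / (16 * L)) (δ / 12)), by positivity, ?_, ?_, ?_, ?_⟩
    · exact (min_le_left _ _).trans (min_le_left _ _)
    · exact (min_le_left _ _).trans (min_le_right _ _)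
    · have : min (min (1 / 12) ε0) (min (c / (16 * L)) (δ / 12)) ≤ c / (16 * L) :=
        (min_le_right _ _).trans (min_le_left _ _)
      rw [le_div_iff₀ (by positivity)] at this
      linarith
    · exact (min_le_right _ _).trans (min_le_right _ _)
  obtain ⟨c1, hc1, hc1ρ, hc1ε⟩ : ∃ c1 > 0, c1 ≤ 2 * ρ0 ∧ c1 ≤ 2 * ε :=
    ⟨min (2 * ρ0) (2 * ε), by positivity, min_le_left _ _, min_le_right _ _⟩
  obtain ⟨D, hD, hDc⟩ : ∃ D > 0, D * c1 = 8 * M := ⟨8 * M / c1, by positivity, by field_simp⟩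
  obtain ⟨K, hK, hKc⟩ : ∃ K > 0, c * K = 16 := ⟨16 / c, by positivity, by field_simp⟩
  obtain ⟨xm, hxm0, hxm⟩ : ∃ xm > 0, ∀ y, 0 ≤ y → y ≤ M → r y ≤ 1 - δ / 3 → xm ≤ y := by
    refine ⟨min 1 (δ / (3 * L)), by positivity, ?_⟩
    intro y hy hyM hr
    by_contra hlt
    push Not at hlt
    have h1 : y < 1 := hlt.trans_le (min_le_left _ _)
    have h2 : y < δ / (3 * L) := hlt.trans_le (min_le_right _ _)
    rw [lt_div_iff₀ (by positivity)] at h2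
    have h3 := (abs_le.mp (F.f3 y hy hyM)).1
    have h4 : L * y ^ 2 ≤ L * y := by
      apply mul_le_mul_of_nonneg_left _ hL.le
      nlinarith
    linarith
  obtain ⟨C2, hC2⟩ : ∃ C2, C2 = 16 * L * K ^ 2 + 16 + 2 * (3 * L + K)
    + 4 / a * (L + a * (K + L)) := ⟨_, rfl⟩
  have hC20 : 0 < C2 := by rw [hC2]; positivity
  obtain ⟨K2, hK20, hK2, hK2'⟩ : ∃ K2 > 0, C2 ≤ 2 * c * K2 ∧ K + 1 / a ≤ K2 * xm ^ 2 := by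
    refine ⟨max (C2 / (2 * c)) ((K + 1 / a) / xm ^ 2), by positivity, ?_, ?_⟩
    · have := le_max_left (C2 / (2 * c)) ((K + 1 / a) / xm ^ 2)
      rw [div_le_iff₀ (by positivity)] at this
      linarith
    · have := le_max_right (C2 / (2 * c)) ((K + 1 / a) / xm ^ 2)
      rwa [div_le_iff₀ (by positivity)] at this
  obtain ⟨K3, hK30, hK3⟩ : ∃ K3 > 0, C2 + 8 * K * K2 ≤ 2 * c * K3 :=
    ⟨(C2 + 8 * K * K2) / (2 * c), by positivity, by field_simp; rfl⟩
  refine ⟨min (1 / 4) (min (min (ε / K) (ε / 8)) (δ / (12 * (D * M)))), by positivity, K, hK,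
    K2, hK20, K3, hK30, min_le_left _ _, ?_⟩
  intro η hη hηlt x q hx hdx hdq hx0 hq0 hq0' hne
  have hη4 : η ≤ 1 / 4 := hηlt.le.trans (min_le_left _ _)
  have hη' := hηlt.le.trans (min_le_right _ _)
  have hKη : K * η ≤ ε := by
    have := hη'.trans ((min_le_left _ _).trans (min_le_left _ _))
    rw [le_div_iff₀ hK] at this
    linarith
  have hηε : 8 * η ≤ ε := by
    have := hη'.trans ((min_le_left _ _).trans (min_le_right _ _))
    linarith
  have hDη : D * η * M ≤ δ / 12 := by
    have := hη'.trans (min_le_right _ _)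
    rw [le_div_iff₀ (by positivity)] at this
    linarith
  obtain ⟨T1, a1, a2, a3, a4⟩ := eos_phase0a F δ ε η D c1 xm hδ hδ1 hε hεδ hη hη4 hc1 hc1ρ hc1ε
    hD hDc hDη hxm0 hxm x q hx hdx hdq hx0 hq0 hq0'
  have hqT1 : q T1 ≤ 1 - δ + δ / 12 := by
    have e1 : D * η * x 0 ≤ D * η * M :=
      mul_le_mul_of_nonneg_left (by linarith) (by positivity)
    have e2 : 0 ≤ D * η * x T1 := mul_nonneg (by positivity) (hx _)
    linarith
  obtain ⟨T2, b1, b2, b3⟩ := eos_phase0b F δ ε η D c1 hδ hδ1 hε hεε0 hη hη4 hηε hc1 hc1ε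
    hD hDc hDη x q hx hdx hdq T1 (lt_of_le_of_ne (hx T1) (hne T1 (by linarith)).symm) a1 a2 hqT1 a4
  obtain ⟨T, d1, d2, d3⟩ := eos_phase1 F δ c ε η xm K hδ hδ1 hc hcκ hcM hε hε12 hεε0 hεL hεδ hη hη4
    hKc hxm0 hxm x q hx hdx hdq T2 b1 b2 b3
  refine ⟨T, ?_⟩
  have main : ∀ t, T ≤ t → c0 < q t ∧ |q t - r (x t)| ≤ K * η ∧
        |q t - r (x t) - η / a| ≤ K2 * η * x t ^ 2 + K3 * η ^ 2 := by
    intro t ht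
    induction t, ht using Nat.le_induction with
    | base =>
      refine ⟨d1, d2, ?_⟩
      have h1 : |q T - r (x T) - η / a| ≤ K * η + η / a := by
        refine (abs_sub _ _).trans (add_le_add d2 ?_)
        rw [abs_of_pos (by positivity)]
      have h2 : K * η + η / a = η * (K + 1 / a) := by ring
      have h3 : η * (K + 1 / a) ≤ η * (K2 * xm ^ 2) := by gcongr
      have h4 : η * (K2 * xm ^ 2) ≤ η * (K2 * x T ^ 2) := by gcongr
      have h5 : 0 ≤ K3 * η ^ 2 := by positivity
      linarith
    | succ t ht ih =>
      exact eos_phase2 F c ε η K K2 K3 C2 hc hcκ hcM hε hε12 hεε0 hεL hη hη4 hKc hK hKη hC2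
        hK2 hK20 hK3 (x t) (q t) (x (t + 1)) (q (t + 1)) (hx t) (hdx t) (hdq t) ih.1 ih.2.1 ih.2.2
        (hr1 _)
  exact fun t ht => (main t ht).2

/-- Integrating a pointwise bound on the derivative. -/
theorem eos_int_bound (g g' : ℝ → ℝ) (b C : ℝ) (n : ℕ) (hg : ∀ x, HasDerivAt g (g' x) x)
    (h0 : g 0 = 0) (hC : 0 ≤ C) (hb : ∀ x, 0 ≤ x → x ≤ b → |g' x| ≤ C * x ^ n) :
    ∀ x, 0 ≤ x → x ≤ b → |g x| ≤ C * x ^ (n + 1) := by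
  intro x hx hxb
  rcases hx.eq_or_lt with rfl | hx0
  · simp [h0]
  obtain ⟨ξ, hξ, e⟩ := exists_hasDerivAt_eq_slope g g' hx0
    (fun y _ => (hg y).continuousAt.continuousWithinAt) (fun y _ => hg y)
  have e2 : g x = g' ξ * x := by
    rw [e, h0]; field_simp; ring
  rw [e2, abs_mul, abs_of_pos hx0, pow_succ, ← mul_assoc]
  have h1 := hb ξ hξ.1.le (hξ.2.le.trans hxb)
  have h2 : C * ξ ^ n ≤ C * x ^ n := by
    have := hξ.1.le
    have := hξ.2.le
    gcongr
  exact mul_le_mul_of_nonneg_right (h1.trans h2) hx0.le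

theorem eos_bdd (g : ℝ → ℝ) (hg : Continuous g) (b : ℝ) :
    ∃ C > 0, ∀ x, 0 ≤ x → x ≤ b → |g x| ≤ C := by
  obtain ⟨C, hC⟩ := (isCompact_Icc (a := (0 : ℝ)) (b := b)).exists_bound_of_continuousOn
    hg.continuousOn
  refine ⟨max C 1, by positivity, fun x h1 h2 => ?_⟩
  exact (hC x ⟨h1, h2⟩).trans (le_max_left _ _)

theorem eos_deriv_neg_of_even (f : ℝ → ℝ) (hf : ∀ x, f (-x) = f x) (x : ℝ) :
    deriv f (-x) = -deriv f x := by
  have h := deriv_comp_neg f x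
  have e : (fun y => f (-y)) = f := funext hf
  rw [e] at h
  linarith

theorem eos_deriv_neg_of_odd (f : ℝ → ℝ) (hf : ∀ x, f (-x) = -f x) (x : ℝ) :
    deriv f (-x) = deriv f x := by
  have h := deriv_comp_neg f x
  have e : (fun y => f (-y)) = fun y => -f y := funext hf
  rw [e, deriv.fun_neg] at h
  linarith

theorem eos_r_anti (r : ℝ → ℝ) (hR : AssumptionR r) : StrictAntiOn r (Set.Ici 0) := by
  obtain ⟨_, hC, _, _, hneg, _, _⟩ := hR
  refine strictAntiOn_of_deriv_neg (convex_Ici 0) hC.continuous.continuousOn ?_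
  intro x hx
  rw [interior_Ici] at hx
  exact hneg x hx

theorem eos_r_pos (r : ℝ → ℝ) (hR : AssumptionR r) (x : ℝ) : 0 < r x := by
  have ha := eos_r_anti r hR
  obtain ⟨hev, _, _, _, _, hT, _⟩ := hR
  have key : ∀ y, 0 ≤ y → 0 < r y := by
    intro y hy
    have h1 : r (y + 1) < r y := ha (Set.mem_Ici.mpr hy) (Set.mem_Ici.mpr (by linarith))
      (by linarith)
    have h2 : 0 ≤ r (y + 1) := by
      refine le_of_tendsto hT ?_
      filter_upwards [eventually_ge_atTop (y + 1)] with z hz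
      exact ha.antitoneOn (Set.mem_Ici.mpr (by linarith)) (Set.mem_Ici.mpr (by linarith)) hz
    linarith
  rcases le_total 0 x with h | h
  · exact key x h
  · rw [← hev]; exact key (-x) (by linarith)

theorem eos_r_le_one (r : ℝ → ℝ) (hR : AssumptionR r) (x : ℝ) : r x ≤ 1 := by
  have ha := eos_r_anti r hR
  obtain ⟨hev, _, h0, _, _, hT, _⟩ := hR
  have key : ∀ y, 0 ≤ y → r y ≤ 1 := by
    intro y hy
    rw [← h0]
    exact ha.antitoneOn (Set.mem_Ici.mpr le_rfl) (Set.mem_Ici.mpr hy) hy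
  rcases le_total 0 x with h | h
  · exact key x h
  · rw [← hev]; exact key (-x) (by linarith)

/-- `sSup` of a set containing `0` is nonnegative (junk value included). -/
theorem eos_sSup_nonneg (S : Set ℝ) (h0 : (0 : ℝ) ∈ S) : 0 ≤ sSup S := by
  by_cases h : BddAbove S
  · exact le_csSup h h0
  · rw [Real.sSup_of_not_bddAbove h]

/-- Deduce the analytic facts. -/
theorem eos_facts (φ r rhat : ℝ → ℝ) (δ : ℝ)
    (hPhi : AssumptionPhi φ)
    (hrdef : ∀ z : ℝ, z ≠ 0 → r z = φ z * deriv φ z / z)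
    (hR : AssumptionR r) (hR2 : AssumptionR2 r)
    (hrhat : ∀ s : ℝ, 0 < s → s ≤ 1 → 0 ≤ rhat s ∧ r (rhat s) = s)
    (hδ : δ ∈ Set.Ioo 0 (1 - cZeroN r)) :
    ∃ M κ L ε0 ρ0 : ℝ, EosFacts r (deriv r) (fun x => φ x ^ 2) (cZeroN r) (-deriv (deriv r) 0)
      M κ L ε0 ρ0 := by
  have hanti := eos_r_anti r hR
  have hpos := eos_r_pos r hR
  have hle1 := eos_r_le_one r hR
  obtain ⟨hev, hC1, hr0, hd0, hneg, hT, _⟩ := hR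
  obtain ⟨hC4, _, hg, _, hk, _⟩ := hR2
  obtain ⟨hodd, hmono, hlip, hφ2, hφ0, hφ'0, hφT, hφB⟩ := hPhi
  have hc01 : cZeroN r < 1 := by linarith [hδ.1, hδ.2]
  -- differentiability
  have hC4' := hC4
  have D1 : ContDiff ℝ 3 (deriv r) := ((contDiff_succ_iff_deriv (n := 3)).mp hC4).2.2
  have D2 : ContDiff ℝ 2 (deriv (deriv r)) := ((contDiff_succ_iff_deriv (n := 2)).mp D1).2.2
  have D3 : ContDiff ℝ 1 (deriv (deriv (deriv r))) :=
    ((contDiff_succ_iff_deriv (n := 1)).mp D2).2.2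
  have D4 : Continuous (deriv (deriv (deriv (deriv r)))) := D3.continuous_deriv le_rfl
  have H0 : ∀ x, HasDerivAt r (deriv r x) x := fun x =>
    (hC4.differentiable (by norm_num) x).hasDerivAt
  have H1 : ∀ x, HasDerivAt (deriv r) (deriv (deriv r) x) x := fun x =>
    (D1.differentiable (by norm_num) x).hasDerivAt
  have H2 : ∀ x, HasDerivAt (deriv (deriv r)) (deriv (deriv (deriv r)) x) x := fun x =>
    (D2.differentiable (by norm_num) x).hasDerivAt
  have H3 : ∀ x, HasDerivAt (deriv (deriv (deriv r))) (deriv (deriv (deriv (deriv r))) x) x :=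
    fun x => (D3.differentiable (by norm_num) x).hasDerivAt
  have odd1 := eos_deriv_neg_of_even r hev
  have ev2 := eos_deriv_neg_of_odd (deriv r) odd1
  have odd3 := eos_deriv_neg_of_even _ ev2
  have h30 : deriv (deriv (deriv r)) 0 = 0 := by
    have := odd3 0
    rw [neg_zero] at this
    linarith
  -- the point z₀
  set z0 := zZero r with hz0
  have hz0c : r z0 ≤ cZeroN r := le_max_left _ _
  have hz00 : 0 ≤ z0 := eos_sSup_nonneg _ (by simp)
  have hz0p : 0 < z0 := by
    rcases hz00.eq_or_lt with h | h
    · rw [← h, hr0] at hz0c; linarith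
    · exact h
  have hgz : ∀ x, 0 < x → x < z0 → -(1 / 2) ≤ x * deriv r x / r x := by
    intro x hx hxz
    obtain ⟨z, hz, hxz'⟩ := exists_lt_of_lt_csSup ⟨0, by simp⟩ hxz
    have := hg (Set.mem_Ioi.mpr hx) (Set.mem_Ioi.mpr (hx.trans hxz')) hxz'
    have hz' : -(1 / 2) ≤ z * deriv r z / r z := hz
    simp only at this
    linarith
  have hgcont : Continuous (fun x => x * deriv r x / r x) :=
    (continuous_id.mul D1.continuous).div hC1.continuous (fun x => (hpos x).ne')
  obtain ⟨ζ, hζ, hgζ⟩ : ∃ ζ, z0 < ζ ∧ -(3 / 4) ≤ ζ * deriv r ζ / r ζ := by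
    obtain ⟨d, hd, hd'⟩ := Metric.continuousAt_iff.mp (hgcont.continuousAt (x := z0)) (1 / 8)
      (by norm_num)
    have hm : 0 < min d z0 := by positivity
    have hm1 := min_le_left d z0
    have hm2 := min_le_right d z0
    have e1 := hd' (x := z0 - min d z0 / 2) (by
      rw [Real.dist_eq, abs_lt]; constructor <;> linarith)
    have e2 := hd' (x := z0 + min d z0 / 2) (by
      rw [Real.dist_eq, abs_lt]; constructor <;> linarith)
    rw [Real.dist_eq, abs_lt] at e1 e2
    have e3 := hgz (z0 - min d z0 / 2) (by linarith) (by linarith)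
    exact ⟨z0 + min d z0 / 2, by linarith, by linarith [e1.2, e2.1]⟩
  have hζ0 : 0 < ζ := hz0p.trans hζ
  set M := max 1 ζ with hM
  have hM1 : 1 ≤ M := le_max_left _ _
  have hMζ : ζ ≤ M := le_max_right _ _
  have hM0 : 0 < M := by linarith
  -- lower bound for the derivative
  obtain ⟨κ, hκ, f1⟩ : ∃ κ > 0, ∀ x, 0 ≤ x → x ≤ M → κ * x ^ 2 ≤ -(x * deriv r x) := by
    have hnM := hneg M hM0
    have hrM := hpos M
    refine ⟨r M * -deriv r M / (M * r M), by
      apply div_pos (mul_pos hrM (by linarith)) (by positivity), ?_⟩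
    intro x hx hxM
    rcases hx.eq_or_lt with rfl | hx0
    · simp
    have hnx := hneg x hx0
    have h1 : M * r M / deriv r M ≤ x * r x / deriv r x :=
      hk.antitoneOn (Set.mem_Ioi.mpr hx0) (Set.mem_Ioi.mpr hM0) hxM
    have h2 : r M ≤ r x := hanti.antitoneOn (Set.mem_Ici.mpr hx) (Set.mem_Ici.mpr hM0.le) hxM
    rw [← neg_div_neg_eq (M * r M), ← neg_div_neg_eq (x * r x),
      div_le_div_iff₀ (by linarith) (by linarith)] at h1
    have h3 : x * r M * -deriv r M ≤ x * r x * -deriv r M :=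
      mul_le_mul_of_nonneg_right (mul_le_mul_of_nonneg_left h2 hx) (by linarith)
    have h4 : x * r M * -deriv r M ≤ M * r M * -deriv r x := by linarith
    have h5 : r M * -deriv r M / (M * r M) * x ≤ -deriv r x := by
      rw [div_mul_eq_mul_div, div_le_iff₀ (by positivity)]
      linarith
    have := mul_le_mul_of_nonneg_left h5 hx
    linarith
  -- bounds on higher derivatives
  obtain ⟨A, hA, hAb⟩ := eos_bdd _ D4 M
  obtain ⟨B, hB, hBb⟩ := eos_bdd _ D2.continuous (2 * M)
  have g3 := eos_int_bound (deriv (deriv (deriv r))) _ M A 0 H3 h30 hA.le (by simpa using hAb)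
  have g2 := eos_int_bound (fun x => deriv (deriv r) x - deriv (deriv r) 0) _ M A 1
    (fun x => (H2 x).sub_const _) (by simp) hA.le (by simpa using g3)
  have g1 := eos_int_bound (fun x => deriv r x - deriv (deriv r) 0 * x)
    (fun x => deriv (deriv r) x - deriv (deriv r) 0 * 1) M A 2
    (fun x => (H1 x).sub ((hasDerivAt_id x).const_mul _)) (by simp [hd0]) hA.le
    (by simpa using g2)
  have k1 := eos_int_bound (deriv r) _ (2 * M) B 0 H1 hd0 hB.le (by simpa using hBb)
  have k0 := eos_int_bound (fun x => r x - 1) _ (2 * M) B 1 (fun x => (H0 x).sub_const _)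
    (by simp [hr0]) hB.le (by simpa using k1)
  have hφd : ∀ x, HasDerivAt φ (deriv φ x) x := fun x =>
    (hφ2.differentiable (by norm_num) x).hasDerivAt
  have hφr : ∀ x, φ x * deriv φ x = x * r x := by
    intro x
    by_cases hx : x = 0
    · rw [hx, hφ0]; simp
    · rw [hrdef x hx]; field_simp
  have kw := eos_int_bound (fun x => φ x ^ 2 - x ^ 2) (fun x => 2 * x * (r x - 1)) (2 * M)
    (2 * B) 3 (fun x => by
      have h1 := ((hφd x).pow 2).sub ((hasDerivAt_id x).pow 2)
      have := hφr x
      refine HasDerivAt.congr_deriv (f := fun x => φ x ^ 2 - x ^ 2) h1 ?_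
      simp only [id, Nat.cast_ofNat]
      norm_num
      linarith) (by simp [hφ0]) (by positivity) (by
      intro x hx hxb
      rw [abs_mul, abs_of_nonneg (by positivity : 0 ≤ 2 * x)]
      have := mul_le_mul_of_nonneg_left (k0 x hx hxb) (by positivity : 0 ≤ 2 * x)
      refine this.trans (le_of_eq ?_)
      ring)
  have hABpos : 0 < A + 2 * B := by positivity
  have f2 : ∀ x, 0 ≤ x → x ≤ M →
      |-(x * deriv r x) - -deriv (deriv r) 0 * x ^ 2| ≤ (A + 2 * B) * x ^ 4 := by
    intro x hx hxM
    have e : -(x * deriv r x) - -deriv (deriv r) 0 * x ^ 2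
        = -(x * (deriv r x - deriv (deriv r) 0 * x)) := by ring
    rw [e, abs_neg, abs_mul, abs_of_nonneg hx]
    have h1 := mul_le_mul_of_nonneg_left (g1 x hx hxM) hx
    have h2 : 0 ≤ 2 * B * x ^ 4 := by positivity
    have h3 : x * (A * x ^ (2 + 1)) = A * x ^ 4 := by ring
    linarith
  have f3 : ∀ x, 0 ≤ x → x ≤ M → |r x - 1| ≤ (A + 2 * B) * x ^ 2 := by
    intro x hx hxM
    have h1 := k0 x hx (by linarith)
    have h2 : 0 ≤ (A + B) * x ^ 2 := by positivity
    have h3 : B * x ^ (1 + 1) = B * x ^ 2 := by ring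
    linarith
  have slope : ∀ (f f' : ℝ → ℝ), (∀ x, HasDerivAt f (f' x) x) → ∀ x y, 0 ≤ x → x ≤ 2 * M →
      0 ≤ y → y ≤ 2 * M → ∃ ξ, 0 ≤ ξ ∧ ξ ≤ 2 * M ∧ |ξ - x| ≤ |y - x| ∧
      f y - f x = f' ξ * (y - x) := by
    intro f f' hf x y hx hx2 hy hy2
    rcases lt_trichotomy x y with h | h | h
    · obtain ⟨ξ, hξ, e⟩ := exists_hasDerivAt_eq_slope f f' h
        (fun y _ => (hf y).continuousAt.continuousWithinAt) (fun y _ => hf y)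
      have h1 := hξ.1
      have h2 := hξ.2
      refine ⟨ξ, by linarith, by linarith, ?_, ?_⟩
      · rw [abs_of_pos (by linarith), abs_of_pos (by linarith)]; linarith
      · rw [e]; have : y - x ≠ 0 := by linarith
        field_simp
    · subst h; exact ⟨x, hx, hx2, le_rfl, by simp⟩
    · obtain ⟨ξ, hξ, e⟩ := exists_hasDerivAt_eq_slope f f' h
        (fun y _ => (hf y).continuousAt.continuousWithinAt) (fun y _ => hf y)
      have h1 := hξ.1
      have h2 := hξ.2
      refine ⟨ξ, by linarith, by linarith, ?_, ?_⟩
      · rw [abs_of_neg (by linarith), abs_of_neg (by linarith)]; linarith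
      · rw [e]; have : x - y ≠ 0 := by linarith
        field_simp; ring
  have f4 : ∀ x y, 0 ≤ x → x ≤ M → 0 ≤ y → y ≤ 2 * M →
      |r y - r x - deriv r x * (y - x)| ≤ (A + 2 * B) * (y - x) ^ 2 := by
    intro x y hx hxM hy hyM
    obtain ⟨ξ, x1, x2, x3, x4⟩ := slope r _ H0 x y hx (by linarith) hy hyM
    obtain ⟨ξ', y1, y2, y3, y4⟩ := slope (deriv r) _ H1 x ξ hx (by linarith) x1 x2
    have e : r y - r x - deriv r x * (y - x) = deriv (deriv r) ξ' * ((ξ - x) * (y - x)) := by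
      rw [x4, ← mul_assoc, ← y4]; ring
    rw [e, abs_mul, abs_mul, ← sq_abs (y - x)]
    have h1 := hBb ξ' y1 y2
    calc |deriv (deriv r) ξ'| * (|ξ - x| * |y - x|) ≤ B * (|y - x| * |y - x|) := by gcongr
      _ ≤ (A + 2 * B) * (|y - x| * |y - x|) := by
        apply mul_le_mul_of_nonneg_right _ (by positivity); linarith
      _ = _ := by ring
  have f5 : ∀ x, 0 ≤ x → x ≤ M → |φ x ^ 2 - x ^ 2| ≤ (A + 2 * B) * x ^ 4 := by
    intro x hx hxM
    have h1 := kw x hx (by linarith)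
    have h2 : 0 ≤ A * x ^ 4 := by positivity
    have h3 : 2 * B * x ^ (3 + 1) = 2 * B * x ^ 4 := by ring
    linarith
  have apos : 0 < -deriv (deriv r) 0 := by
    by_contra hcon
    push Not at hcon
    have hx0 : 0 < min 1 (κ / (2 * (A + 2 * B))) := by positivity
    set y := min 1 (κ / (2 * (A + 2 * B))) with hy
    have hy1 : y ≤ 1 := min_le_left _ _
    have hy2 : y ≤ κ / (2 * (A + 2 * B)) := min_le_right _ _
    rw [le_div_iff₀ (by positivity)] at hy2
    have e1 := f1 y hx0.le (by linarith)
    have e2 := (abs_le.mp (f2 y hx0.le (by linarith))).2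
    have e3 : -deriv (deriv r) 0 * y ^ 2 ≤ 0 := by nlinarith [sq_nonneg y]
    have e4 : κ * y ^ 2 ≤ (A + 2 * B) * y ^ 4 := by linarith
    have e5 : (A + 2 * B) * y ^ 4 ≤ (A + 2 * B) * y * y ^ 2 := by
      have : y ^ 4 ≤ y ^ 3 := pow_le_pow_of_le_one hx0.le hy1 (by norm_num)
      have := mul_le_mul_of_nonneg_left this hABpos.le
      linarith
    have e6 : (A + 2 * B) * y * y ^ 2 ≤ κ / 2 * y ^ 2 :=
      mul_le_mul_of_nonneg_right (by linarith) (sq_nonneg y)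
    have : 0 < κ * y ^ 2 := by positivity
    linarith
  have φabs1 : ∀ x, |φ x| ≤ 1 := by
    intro x
    rw [abs_le]
    exact ⟨hmono.monotone.le_of_tendsto hφB x, hmono.monotone.ge_of_tendsto hφT x⟩
  have φabs2 : ∀ x, |φ x| ≤ |x| := by
    intro x
    have := hlip.dist_le_mul x 0
    simpa [Real.dist_eq, hφ0] using this
  have ha' : ∀ x y, 0 ≤ x → 0 ≤ y → r x ≤ r y → y ≤ x := by
    intro x y hx hy h
    exact (hanti.le_iff_ge (Set.mem_Ici.mpr hx) (Set.mem_Ici.mpr hy)).mp h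
  have hgr : ∀ x s, 0 ≤ s → x * deriv r x / r x ≥ -s → -(x * deriv r x) ≤ s * r x := by
    intro x s hs h
    rw [ge_iff_le, le_div_iff₀ (hpos x)] at h
    linarith
  refine ⟨M, κ, A + 2 * B, r z0 - r ζ, r M, ?_⟩
  refine ⟨?_, apos, hM1, hκ, hABpos, ?_, hpos M, f1, f2, f3, f4, f5, fun x => sq_nonneg _,
    ?_, ?_, ?_, ?_, ?_⟩
  · have : r (zOne r) + 1 / 2 ≤ cZeroN r := le_max_right _ _
    linarith [hpos (zOne r)]
  · have := hanti (Set.mem_Ici.mpr hz00) (Set.mem_Ici.mpr hζ0.le) hζ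
    linarith
  · intro x
    have := φabs1 x
    simpa using sq_le_one_iff_abs_le_one _ |>.mpr this
  · intro x
    exact sq_le_sq.mpr (φabs2 x)
  · intro x hx h
    have hxζ : x ≤ ζ := ha' ζ x hζ0.le hx (by linarith)
    refine ⟨by linarith, ?_⟩
    rcases hx.eq_or_lt with rfl | hx0
    · simp [hr0]; norm_num
    · have : ζ * deriv r ζ / r ζ ≤ x * deriv r x / r x :=
        hg.antitoneOn (Set.mem_Ioi.mpr hx0) (Set.mem_Ioi.mpr hζ0) hxζ
      exact hgr x (3 / 4) (by norm_num) (by linarith)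
  · intro x q hx hq hq1 hqr
    have hq0 : 0 < q := lt_of_lt_of_le (hpos z0) (by linarith)
    obtain ⟨hy0, hry⟩ := hrhat q hq0 hq1
    set y := rhat q with hy
    have hxy : x ≤ y := ha' y x hy0 hx (by rw [hry]; exact hqr)
    have hyz : y ≤ z0 := ha' z0 y hz00 hy0 (by linarith)
    have hmon : MonotoneOn (fun z => z * r z ^ 2) (Set.Icc 0 z0) := by
      have hder : ∀ z, HasDerivAt (fun z => z * r z ^ 2)
          (1 * r z ^ 2 + z * (2 * r z * deriv r z)) z := by
        intro z
        have := (hasDerivAt_id z).mul ((H0 z).pow 2)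
        refine HasDerivAt.congr_deriv (f := fun z => z * r z ^ 2) this ?_
        norm_num
      refine monotoneOn_of_deriv_nonneg (convex_Icc 0 z0)
        (fun z _ => (hder z).continuousAt.continuousWithinAt)
        (fun z _ => (hder z).differentiableAt.differentiableWithinAt) ?_
      intro z hz
      rw [interior_Icc] at hz
      rw [(hder z).deriv]
      have h1 := hgr z (1 / 2) (by norm_num) (hgz z hz.1 hz.2)
      have h2 := mul_le_mul_of_nonneg_left h1 (hpos z).le
      linarith
    have h1 : x * r x ^ 2 ≤ y * r y ^ 2 := hmon ⟨hx, by linarith⟩ ⟨hy0, hyz⟩ hxy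
    rw [hry] at h1
    have h2 : x * (2 * r x / q - 1) ≤ y := by
      have e : 2 * r x / q - 1 ≤ r x ^ 2 / q ^ 2 := by
        have : r x ^ 2 / q ^ 2 = (r x / q) ^ 2 := by rw [div_pow]
        rw [this, mul_div_assoc]
        linarith [sq_nonneg (r x / q - 1)]
      calc x * (2 * r x / q - 1) ≤ x * (r x ^ 2 / q ^ 2) := mul_le_mul_of_nonneg_left e hx
        _ = x * r x ^ 2 / q ^ 2 := by ring
        _ ≤ y * q ^ 2 / q ^ 2 := by gcongr
        _ = y := by field_simp
    have h3 : 0 ≤ x * (2 * r x / q - 1) := by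
      apply mul_nonneg hx
      have : 2 ≤ 2 * r x / q := by rw [le_div_iff₀ hq0]; linarith
      linarith
    have h4 := hanti.antitoneOn (Set.mem_Ici.mpr h3) (Set.mem_Ici.mpr hy0) h2
    rwa [hry] at h4
  · intro x hx hxM
    exact hanti.antitoneOn (Set.mem_Ici.mpr hx) (Set.mem_Ici.mpr hM0.le) hxM

/-- EoS regime, Phase II, for the single-neuron nonlinear network. -/
theorem eos_phase_two_nonlinear (φ r rhat : ℝ → ℝ) (δ : ℝ)
    (hPhi : AssumptionPhi φ)
    (hr0 : r 0 = 1) (hrdef : ∀ z : ℝ, z ≠ 0 → r z = φ z * deriv φ z / z)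
    (hR : AssumptionR r) (hR2 : AssumptionR2 r)
    (hrhat : ∀ s : ℝ, 0 < s → s ≤ 1 → 0 ≤ rhat s ∧ r (rhat s) = s)
    (hR2' : rhat (1 / 2) * deriv r (rhat (1 / 2)) > -(1 / 2))
    (hδ : δ ∈ Set.Ioo 0 (1 - cZeroN r)) :
    ∃ η₀ > (0 : ℝ), ∃ c > (0 : ℝ), ∃ C > (0 : ℝ),
      ∀ η : ℝ, 0 < η → η < η₀ →
        ∀ p q : ℕ → ℝ, NonlinDyn φ r η p q →
          |p 0| ≤ 1 → q 0 ∈ Set.Ioo (cZeroN r) (1 - δ) →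
          (∀ t : ℕ, q t < 1 → p t ≠ 0) →
          (∃ tb : ℕ, c * (1 - q 0) / η ≤ (tb : ℝ) ∧
            q tb ≤ 1 ∧ ∀ t : ℕ, tb < t → 1 < q t) ∧
          Tendsto p atTop (nhds 0) ∧
          ∃ qstar : ℝ, Tendsto q atTop (nhds qstar) ∧
            |qstar - 1 + η / deriv (deriv r) 0| ≤ C * η ^ 2 := by
  have hfac := eos_facts φ r rhat δ hPhi hrdef hR hR2 hrhat hδ
  obtain ⟨M, κ, L, ε0, ρ0, F⟩ := hfac
  have hr1 := eos_r_le_one r hR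
  have ha := F.a_pos
  have hc0 := F.c0_half
  have hδ0 := hδ.1
  have hδ1 : δ < 1 := by linarith [hδ.2]
  obtain ⟨hev, hC1, -, -, -, -, -⟩ := hR
  obtain ⟨hodd, hmono, -, -, hφ0, -, -, -⟩ := hPhi
  obtain ⟨η₁, hη₁, K, hK, K2, hK2, K3, hK3, hη₁4, core⟩ := eos_core F hr1 δ hδ0 hδ1
  set a := -deriv (deriv r) 0 with hadef
  refine ⟨min η₁ (min (1 / (2 * a * K3)) (δ / 16)), by positivity, 1 / 16, by norm_num, K3, hK3, ?_⟩
  intro η hη hηlt p q hdyn hp0 hq0 hne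
  have e1 : η < η₁ := hηlt.trans_le (min_le_left _ _)
  have e2 : η < 1 / (2 * a * K3) :=
    hηlt.trans_le ((min_le_right _ _).trans (min_le_left _ _))
  have e3 : η < δ / 16 := hηlt.trans_le ((min_le_right _ _).trans (min_le_right _ _))
  have hη4 : η ≤ 1 / 4 := by linarith
  obtain ⟨hdp, hdq⟩ := hdyn
  have hrabs : ∀ z, r |z| = r z := by
    intro z
    rcases abs_choice z with h | h <;> rw [h]
    exact hev z
  have hwabs : ∀ z, φ |z| ^ 2 = φ z ^ 2 := by
    intro z
    rcases abs_choice z with h | h <;> rw [h]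
    rw [hodd]; ring
  have hdx : ∀ t, |p (t + 1)| = |1 - 2 * r |p t| / q t| * |p t| := by
    intro t; rw [hdp, abs_mul, hrabs]
  have hdq' : ∀ t, q (t + 1) = ((1 - η * φ |p t| ^ 2) ^ 2)⁻¹ * q t := by
    intro t; rw [hdq, hwabs]
  obtain ⟨T, hT⟩ := core η hη e1 (fun t => |p t|) q (fun t => abs_nonneg _) hdx hdq' hp0 hq0.1 hq0.2
    (fun t h => abs_ne_zero.mpr (hne t h))
  -- monotonicity of `q`
  have hs : ∀ t, 0 ≤ η * φ |p t| ^ 2 ∧ η * φ |p t| ^ 2 ≤ 1 / 4 := by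
    intro t
    have h0 := F.w_nn |p t|
    have h1 := F.w_one |p t|
    refine ⟨by positivity, ?_⟩
    linarith [mul_le_of_le_one_right hη.le h1]
  have hgrow : ∀ t, 0 < q t → q t * (η * φ |p t| ^ 2) ≤ q (t + 1) - q t := by
    intro t hq
    obtain ⟨s0, s1⟩ := hs t
    rw [hdq']
    set s := η * φ |p t| ^ 2
    have hpos : 0 < (1 - s) ^ 2 := by nlinarith
    have h1 : q t + q t * s ≤ ((1 - s) ^ 2)⁻¹ * q t := by
      rw [inv_mul_eq_div, le_div_iff₀ hpos]
      have h2 : (1 + s) * (1 - s) ^ 2 ≤ 1 := by nlinarith [mul_nonneg s0 s0]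
      have := mul_le_mul_of_nonneg_left h2 hq.le
      linarith
    linarith
  have hqpos : ∀ t, q 0 ≤ q t := by
    intro t
    induction t with
    | zero => exact le_rfl
    | succ t ih =>
      have hq : 0 < q t := by linarith [hq0.1]
      have := hgrow t hq
      have := mul_nonneg hq.le (hs t).1
      linarith
  have hqhalf : ∀ t, 1 / 2 < q t := fun t => by linarith [hqpos t, hq0.1]
  have hqmono : Monotone q := monotone_nat_of_le_succ fun t => by
    have h1 := hgrow t (by linarith [hqhalf t])
    have h2 := mul_nonneg (by linarith [hqhalf t] : 0 ≤ q t) (hs t).1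
    linarith
  have hbdd : BddAbove (Set.range q) := by
    refine ⟨1 + K * η, ?_⟩
    rintro _ ⟨t, rfl⟩
    have h1 := hqmono (le_max_left t T)
    have h2 := (abs_le.mp (hT _ (le_max_right t T)).1).2
    have h3 := hr1 |p (max t T)|
    linarith
  obtain ⟨qs, hqs⟩ : ∃ qs, Tendsto q atTop (nhds qs) := ⟨_, tendsto_atTop_ciSup hqmono hbdd⟩
  have hqs' : Tendsto (fun t => q (t + 1)) atTop (nhds qs) := hqs.comp (tendsto_add_atTop_nat 1)
  have hdiff : Tendsto (fun t => q (t + 1) - q t) atTop (nhds 0) := by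
    simpa using hqs'.sub hqs
  have hxlim : Tendsto (fun t => |p t|) atTop (nhds 0) := by
    rw [Metric.tendsto_atTop]
    intro e he
    have hφe : 0 < φ e := by rw [← hφ0]; exact hmono he
    have hlt : 0 < 1 / 2 * (η * φ e ^ 2) := by positivity
    obtain ⟨N, hN⟩ := eventually_atTop.mp (hdiff.eventually (gt_mem_nhds hlt))
    refine ⟨N, fun t ht => ?_⟩
    rw [Real.dist_eq, sub_zero, abs_abs]
    by_contra hcon
    push Not at hcon
    have h1 : φ e ≤ φ |p t| := hmono.monotone hcon
    have h2 : φ e ^ 2 ≤ φ |p t| ^ 2 := by gcongr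
    have h3 := hgrow t (by linarith [hqhalf t])
    have h4 := hN t ht
    have h5 : 1 / 2 * (η * φ |p t| ^ 2) ≤ q t * (η * φ |p t| ^ 2) :=
      mul_le_mul_of_nonneg_right (hqhalf t).le (hs t).1
    have h6 : η * φ e ^ 2 ≤ η * φ |p t| ^ 2 := by gcongr
    linarith
  have hplim : Tendsto p atTop (nhds 0) := (tendsto_zero_iff_abs_tendsto_zero p).mpr hxlim
  have hlim : |qs - 1 - η / a| ≤ K3 * η ^ 2 := by
    have hrl : Tendsto (fun t => r |p t|) atTop (nhds 1) := by
      have := (hC1.continuous.tendsto 0).comp hxlim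
      rw [hr0] at this
      exact this
    have h1 : Tendsto (fun t => |q t - r |p t| - η / a|) atTop (nhds |qs - 1 - η / a|) :=
      ((hqs.sub hrl).sub_const _).abs
    have h2 : Tendsto (fun t => K2 * η * |p t| ^ 2 + K3 * η ^ 2) atTop
        (nhds (K2 * η * 0 ^ 2 + K3 * η ^ 2)) :=
      ((hxlim.pow 2).const_mul _).add_const _
    have h3 := le_of_tendsto_of_tendsto h1 h2
      (eventually_atTop.mpr ⟨T, fun t ht => (hT t ht).2⟩)
    simpa using h3
  have hqs1 : 1 < qs := by
    have h1 := (abs_le.mp hlim).1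
    rw [lt_div_iff₀ (by positivity)] at e2
    have h2 : K3 * η ^ 2 < η / a := by
      rw [lt_div_iff₀ ha]
      nlinarith
    linarith
  refine ⟨?_, hplim, qs, hqs, ?_⟩
  · -- the last time with `q ≤ 1`
    have hex : ∃ n, 1 < q n := (hqs.eventually (lt_mem_nhds hqs1)).exists
    have hn := Nat.find_spec hex
    have hmin := fun m => Nat.find_min (H := hex) (m := m)
    set n := Nat.find hex
    have hn0 : n ≠ 0 := by
      intro h
      rw [h] at hn
      linarith [hq0.2]
    obtain ⟨tb, htb⟩ := Nat.exists_eq_succ_of_ne_zero hn0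
    have hle : ∀ m, m ≤ tb → q m ≤ 1 := fun m hm => not_lt.mp (hmin m (by omega))
    refine ⟨tb, ?_, hle tb le_rfl, fun t ht => ?_⟩
    · have hinc : ∀ m, m ≤ tb + 1 → q m ≤ q 0 + m * (8 * η) := by
        intro m
        induction m with
        | zero => intro _; simp
        | succ k ih =>
          intro hk
          have h1 := ih (by omega)
          have h2 := (eos_qstep' F η |p k| (q k) hη hη4 (by linarith [hqpos k, hq0.1])
            (by linarith [hle k (by omega)])).2.2
          have h3 := hdq' k
          push_cast
          linarith
      have h1 := hinc (tb + 1) le_rfl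
      have h2 : 1 < q (tb + 1) := by rw [htb] at hn; exact hn
      push_cast at h1
      rw [div_le_iff₀ hη]
      linarith [hq0.2]
    · exact lt_of_lt_of_le hn (hqmono (by omega))
  · have : η / deriv (deriv r) 0 = -(η / a) := by rw [hadef, div_neg, neg_neg]
    rw [this, ← sub_eq_add_neg]
    exact hlim
end
end
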